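/- arXiv:1702.00875 — 10 statements merged into one kernel-verified Lean document; each statement's English description precedes it below -/
import Mathlib

section
/- Let d, m, n be positive integers and let c_1, …, c_m be invertible real d×d matrices such that c_i − c_j is invertible whenever i ≠ j. Let f_1, …, f_m : ℝ^d → ℂ be continuous functions and let W be an n-dimensional ℂ-linear subspace of the space of all functions from ℝ^d to ℂ such that for every y ∈ ℝ^d the function x ↦ ∑_{i=1}^m f_i(x + c_i y) belongs to W. Then each f_i is a continuous exponential polynomial. -/
/-- `f : ℝ^d → ℂ` is a continuous exponential polynomial: a finite sum
`∑ₖ pₖ(x) exp(⟨λₖ, x⟩)` with `pₖ` multivariate polynomials and `λₖ ∈ ℂ^d`. -/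
def IsExpPoly {d : ℕ} (f : (Fin d → ℝ) → ℂ) : Prop :=
  ∃ (N : ℕ), 0 < N ∧ ∃ (p : Fin N → MvPolynomial (Fin d) ℂ) (lam : Fin N → Fin d → ℂ),
    ∀ x : Fin d → ℝ, f x = ∑ k, (MvPolynomial.eval (fun j => (x j : ℂ)) (p k)) *
      Complex.exp (∑ j, lam k j * (x j : ℂ))

open Filter Topology in
/-- A continuous one-parameter group in a Banach algebra is differentiable. -/
lemma exists_hasDerivAt_of_map_add {A : Type*} [NormedRing A] [NormedAlgebra ℝ A] [CompleteSpace A]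
    {T : ℝ → A} (hT : Continuous T) (h0 : T 0 = 1) (hadd : ∀ s t, T (s + t) = T s * T t) :
    ∃ a, ∀ t, HasDerivAt T (T t * a) t := by
  let I : ℝ → A := fun x => ∫ t in (0 : ℝ)..x, T t
  have hI : ∀ x, HasDerivAt I (T x) x := fun x => (hT.integral_hasStrictDerivAt 0 x).hasDerivAt
  have hlim : Tendsto (fun t : ℝ => t⁻¹ • I t) (𝓝[≠] 0) (𝓝 1) := by
    have := (hI 0).tendsto_slope_zero
    simpa [I, h0] using this
  have hunit : ∀ᶠ t in 𝓝[≠] (0 : ℝ), IsUnit (t⁻¹ • I t) :=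
    hlim.eventually (Units.isOpen.mem_nhds isUnit_one)
  obtain ⟨ε, hε, hε0⟩ := (hunit.and self_mem_nhdsWithin).exists
  obtain ⟨B, hB⟩ := hε.exists_right_inv
  have hshift : ∀ x, T x * I ε = I (x + ε) - I x := by
    intro x
    have h1 : T x * I ε = ∫ t in (0 : ℝ)..ε, T (x + t) := by
      simp only [I, hadd]
      exact ((ContinuousLinearMap.mul ℝ A (T x)).intervalIntegral_comp_comm
        (hT.intervalIntegrable 0 ε)).symm
    rw [h1, intervalIntegral.integral_comp_add_left, add_zero]
    exact (intervalIntegral.integral_interval_sub_left (hT.intervalIntegrable _ _)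
      (hT.intervalIntegrable _ _)).symm
  have hTeq : T = fun x => (I (x + ε) - I x) * (ε⁻¹ • B) := by
    ext x
    rw [← hshift, mul_assoc, mul_smul_comm, ← smul_mul_assoc, hB, mul_one]
  have hd : ∃ a, HasDerivAt T a 0 := by
    rw [hTeq]
    exact ⟨_, (((hI (0 + ε)).comp_add_const 0 ε).sub (hI 0)).mul_const _⟩
  obtain ⟨a, ha⟩ := hd
  refine ⟨a, fun t => ?_⟩
  have h1 : HasDerivAt (fun s => T (s - t)) a t :=
    HasDerivAt.comp_sub_const t t (by simpa using ha)
  have h2 := h1.const_mul (T t)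
  refine h2.congr_of_eventuallyEq (Eventually.of_forall fun s => ?_)
  simp [← hadd]

lemma Polynomial.exists_derivative_eq {K : Type*} [Field K] [CharZero K] (p : Polynomial K) :
    ∃ q : Polynomial K, Polynomial.derivative q = p := by
  induction p using Polynomial.induction_on' with
  | add p q hp hq =>
    obtain ⟨p', rfl⟩ := hp
    obtain ⟨q', rfl⟩ := hq
    exact ⟨p' + q', by simp⟩
  | monomial n a =>
    refine ⟨Polynomial.monomial (n + 1) (a / (n + 1)), ?_⟩
    have : (n : K) + 1 ≠ 0 := Nat.cast_add_one_ne_zero n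
    rw [Polynomial.derivative_monomial_succ, div_mul_cancel₀ _ this]

/-- The algebra of functions generated by complex polynomials and exponentials of linear forms. -/
def expPolyAlgebra (d : ℕ) : Subalgebra ℂ ((Fin d → ℝ) → ℂ) :=
  Algebra.adjoin ℂ (Set.range (fun (j : Fin d) (x : Fin d → ℝ) => (x j : ℂ)) ∪
    Set.range (fun (p : Fin d × ℂ) (x : Fin d → ℝ) => Complex.exp (p.2 * x p.1)))

lemma coord_comp_polynomial_mul_exp_mem {d : ℕ} (j : Fin d) (p : Polynomial ℂ) (μ : ℂ) :
    (fun x : Fin d → ℝ => p.eval (x j : ℂ) * Complex.exp (μ * x j)) ∈ expPolyAlgebra d := by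
  have h1 : (fun x : Fin d → ℝ => (x j : ℂ)) ∈ expPolyAlgebra d :=
    Algebra.subset_adjoin (Or.inl ⟨j, rfl⟩)
  have h2 : (fun x : Fin d → ℝ => Complex.exp (μ * x j)) ∈ expPolyAlgebra d :=
    Algebra.subset_adjoin (Or.inr ⟨(j, μ), rfl⟩)
  refine mul_mem (?_ : (fun x : Fin d → ℝ => p.eval (x j : ℂ)) ∈ _) h2
  have h3 : (fun x : Fin d → ℝ => p.eval (x j : ℂ)) =
      Polynomial.aeval (fun x : Fin d → ℝ => (x j : ℂ)) p := by
    ext x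
    simp [Polynomial.aeval_pi]
  rw [h3, Polynomial.aeval_eq_sum_range]
  exact sum_mem fun i _ => Subalgebra.smul_mem _ (pow_mem h1 i) _

lemma IsExpPoly.of_fintype {d : ℕ} {ι : Type*} [Fintype ι] [Nonempty ι] {f : (Fin d → ℝ) → ℂ}
    (p : ι → MvPolynomial (Fin d) ℂ) (lam : ι → Fin d → ℂ)
    (h : ∀ x : Fin d → ℝ, f x = ∑ k, (MvPolynomial.eval (fun j => (x j : ℂ)) (p k)) *
      Complex.exp (∑ j, lam k j * (x j : ℂ))) : IsExpPoly f := by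
  let e := (Fintype.equivFin ι).symm
  refine ⟨Fintype.card ι, Fintype.card_pos, p ∘ e, lam ∘ e, fun x => ?_⟩
  rw [h, ← e.sum_comp]
  rfl

lemma IsExpPoly.of_mem_expPolyAlgebra {d : ℕ} {f : (Fin d → ℝ) → ℂ} (hf : f ∈ expPolyAlgebra d) :
    IsExpPoly f := by
  induction hf using Algebra.adjoin_induction with
  | mem f hf =>
    rcases hf with ⟨j, rfl⟩ | ⟨⟨j, μ⟩, rfl⟩
    · exact IsExpPoly.of_fintype (ι := Unit) (fun _ => MvPolynomial.X j) 0 (by simp)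
    · refine IsExpPoly.of_fintype (ι := Unit) 1 (fun _ => Pi.single j μ) fun x => ?_
      simp [Pi.single_apply]
  | algebraMap r =>
    exact IsExpPoly.of_fintype (ι := Unit) (fun _ => MvPolynomial.C r) 0 (by simp)
  | add f g _ _ hf hg =>
    obtain ⟨N, hN, p, lam, hf⟩ := hf
    obtain ⟨M, hM, q, mu, hg⟩ := hg
    have : Nonempty (Fin N) := ⟨⟨0, hN⟩⟩
    exact IsExpPoly.of_fintype (Sum.elim p q) (Sum.elim lam mu) (by simp [hf, hg])
  | mul f g _ _ hf hg =>
    obtain ⟨N, hN, p, lam, hf⟩ := hf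
    obtain ⟨M, hM, q, mu, hg⟩ := hg
    have : Nonempty (Fin N) := ⟨⟨0, hN⟩⟩
    have : Nonempty (Fin M) := ⟨⟨0, hM⟩⟩
    refine IsExpPoly.of_fintype (ι := Fin N × Fin M) (fun k => p k.1 * q k.2)
      (fun k => lam k.1 + mu k.2) fun x => ?_
    rw [Pi.mul_apply, hf, hg, Finset.sum_mul_sum, Fintype.sum_prod_type]
    refine Finset.sum_congr rfl fun k _ => Finset.sum_congr rfl fun l _ => ?_
    simp only [map_mul, Pi.add_apply, add_mul, Finset.sum_add_distrib, Complex.exp_add]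
    ring

/-- Matrix coefficients of a one-parameter group on vectors killed by a power of `a - μ`
are polynomials times `exp (μ t)`. -/
lemma exists_polynomial_of_hasDerivAt {E : Type*} [NormedAddCommGroup E] [NormedSpace ℂ E]
    {T : ℝ → E →L[ℂ] E} {a : E →L[ℂ] E} (hT : ∀ t, HasDerivAt T (T t * a) t) (l : E →L[ℂ] ℂ)
    (μ : ℂ) (k : ℕ) (v : E) (hv : ((a - algebraMap ℂ _ μ) ^ k) v = 0) :
    ∃ p : Polynomial ℂ, ∀ t : ℝ, l (T t v) = p.eval (t : ℂ) * Complex.exp (μ * t) := by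
  induction k generalizing v with
  | zero => exact ⟨0, by simp_all⟩
  | succ k ih =>
    obtain ⟨p, hp⟩ := ih ((a - algebraMap ℂ _ μ) v) (by rw [pow_succ] at hv; exact hv)
    obtain ⟨q, hq⟩ := p.exists_derivative_eq
    have hl : ∀ t, HasDerivAt (fun t => l (T t v)) (l (T t (a v))) t := fun t =>
      (((l.comp (ContinuousLinearMap.apply ℂ E v)).restrictScalars ℝ).hasFDerivAt).comp_hasDerivAt
        t (hT t)
    have he : ∀ t : ℝ, HasDerivAt (fun t : ℝ => Complex.exp (-μ * t))
        (Complex.exp (-μ * t) * (-μ)) t := fun t => by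
      have h1 : HasDerivAt (fun z : ℂ => -μ * z) (-μ) (t : ℂ) := by
        simpa using (hasDerivAt_id (t : ℂ)).const_mul (-μ)
      exact h1.cexp.comp_ofReal
    have hqd : ∀ t : ℝ, HasDerivAt (fun t : ℝ => q.eval (t : ℂ)) (p.eval (t : ℂ)) t := fun t => by
      rw [← hq]; exact (q.hasDerivAt (t : ℂ)).comp_ofReal
    have hexp : ∀ t : ℝ, Complex.exp (μ * t) * Complex.exp (-μ * t) = 1 := fun t => by
      rw [← Complex.exp_add, neg_mul, add_neg_cancel, Complex.exp_zero]
    have hg : ∀ t : ℝ, HasDerivAt (fun t : ℝ => l (T t v) * Complex.exp (-μ * t) - q.eval (t : ℂ))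
        0 t := fun t => by
      refine (((hl t).mul (he t)).sub (hqd t)).congr_deriv ?_
      have h := hp t
      simp only [sub_apply, map_sub, ContinuousLinearMap.algebraMap_apply,
        map_smul, smul_eq_mul] at h
      linear_combination Complex.exp (-μ * t) * h + Polynomial.eval (t : ℂ) p * hexp t
    have hconst := is_const_of_deriv_eq_zero (fun t => (hg t).differentiableAt)
      (fun t => (hg t).deriv)
    refine ⟨q + Polynomial.C (l (T 0 v) * Complex.exp (-μ * (0 : ℝ)) - q.eval ((0 : ℝ) : ℂ)),
      fun t => ?_⟩
    have h := hconst t 0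
    simp only [Polynomial.eval_add, Polynomial.eval_C]
    rw [← h]
    linear_combination -(l (T t v)) * hexp t

lemma coord_comp_one_parameter_group_mem {d : ℕ} (j : Fin d) {E : Type*} [NormedAddCommGroup E]
    [NormedSpace ℂ E] [FiniteDimensional ℂ E] {T : ℝ → E →L[ℂ] E} (hT : Continuous T)
    (h0 : T 0 = 1) (hadd : ∀ s t, T (s + t) = T s * T t) (l : E →L[ℂ] ℂ) (v : E) :
    (fun x : Fin d → ℝ => l (T (x j) v)) ∈ expPolyAlgebra d := by
  have : CompleteSpace E := FiniteDimensional.complete ℂ E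
  obtain ⟨a, ha⟩ := exists_hasDerivAt_of_map_add hT h0 hadd
  have hv : v ∈ ⨆ μ : ℂ, Module.End.maxGenEigenspace (a : E →ₗ[ℂ] E) μ := by
    rw [Module.End.iSup_maxGenEigenspace_eq_top]; trivial
  induction hv using Submodule.iSup_induction' with
  | mem μ v hv =>
    obtain ⟨k, hk⟩ := (Module.End.mem_maxGenEigenspace _ _ _).1 hv
    obtain ⟨p, hp⟩ := exists_polynomial_of_hasDerivAt ha l μ k v (by
      have key : ∀ (k : ℕ) (w : E), ((a - algebraMap ℂ (E →L[ℂ] E) μ) ^ k) w =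
          (((a : E →ₗ[ℂ] E) - μ • 1) ^ k) w := by
        intro k
        induction k with
        | zero => intro w; rfl
        | succ k ih =>
          intro w
          rw [pow_succ, pow_succ]
          exact ih _
      rw [key, hk])
    simp only [hp]
    exact coord_comp_polynomial_mul_exp_mem j p μ
  | zero =>
    simp only [map_zero]
    exact (expPolyAlgebra d).zero_mem
  | add v w _ _ hv hw =>
    simp only [map_add]
    exact add_mem hv hw

/-- Translation by `h`, as a linear map on functions. -/
def rightTranslate {G : Type*} [Add G] (h : G) : (G → ℂ) →ₗ[ℂ] (G → ℂ) :=
  LinearMap.funLeft ℂ ℂ (fun x => x + h)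

@[simp] lemma rightTranslate_apply {G : Type*} [Add G] (h : G) (f : G → ℂ) (x : G) :
    rightTranslate h f x = f (x + h) := rfl

/-- The linear span of all translates of `f`. -/
def translateSpan {G : Type*} [Add G] (f : G → ℂ) : Submodule ℂ (G → ℂ) :=
  Submodule.span ℂ (Set.range fun h => rightTranslate h f)

lemma rightTranslate_mem_translateSpan {G : Type*} [Add G] (f : G → ℂ) (h : G) :
    rightTranslate h f ∈ translateSpan f :=
  Submodule.subset_span ⟨h, rfl⟩

lemma self_mem_translateSpan {G : Type*} [AddZeroClass G] (f : G → ℂ) :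
    f ∈ translateSpan f := by
  convert rightTranslate_mem_translateSpan f 0
  ext x; simp

lemma rightTranslate_mem_of_mem_translateSpan {G : Type*} [AddCommSemigroup G] {f g : G → ℂ}
    (hg : g ∈ translateSpan f) (h : G) : rightTranslate h g ∈ translateSpan f := by
  induction hg using Submodule.span_induction with
  | mem g hg =>
    obtain ⟨k, rfl⟩ := hg
    convert rightTranslate_mem_translateSpan f (h + k) using 1
    ext x; simp [add_assoc]
  | zero => simp
  | add a b _ _ ha hb => rw [map_add]; exact add_mem ha hb
  | smul r a _ ha => rw [map_smul]; exact Submodule.smul_mem _ _ ha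

lemma continuous_of_mem_translateSpan {G : Type*} [Add G] [TopologicalSpace G] [ContinuousAdd G]
    {f g : G → ℂ} (hf : Continuous f) (hg : g ∈ translateSpan f) : Continuous g := by
  induction hg using Submodule.span_induction with
  | mem g hg =>
    obtain ⟨k, rfl⟩ := hg
    exact hf.comp (continuous_id.add continuous_const)
  | zero => exact continuous_const
  | add a b _ _ ha hb => exact ha.add hb
  | smul r a _ ha => exact ha.const_smul r

/-- If all differences of a continuous function on `ℝ^d` have finite-dimensional translate spans,
then so does the function. -/
lemma finiteDimensional_translateSpan_of_sub {d : ℕ} {f : (Fin d → ℝ) → ℂ} (hf : Continuous f)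
    (h : ∀ k, FiniteDimensional ℂ (translateSpan (rightTranslate k f - f))) :
    FiniteDimensional ℂ (translateSpan f) := by
  let g : Fin d × Bool → (Fin d → ℝ) := fun p => Pi.single p.1 (if p.2 then 1 else √2)
  let U : Submodule ℂ ((Fin d → ℝ) → ℂ) := ⨆ p, translateSpan (rightTranslate (g p) f - f)
  have hU : FiniteDimensional ℂ U := Submodule.finiteDimensional_iSup _
  have hUt : ∀ u ∈ U, ∀ k, rightTranslate k u ∈ U := by
    intro u hu k
    induction hu using Submodule.iSup_induction' with
    | mem p u hu =>
      exact Submodule.mem_iSup_of_mem p (rightTranslate_mem_of_mem_translateSpan hu k)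
    | zero => simp
    | add a b _ _ ha hb => rw [map_add]; exact add_mem ha hb
  have tr_add : ∀ a b, rightTranslate (a + b) f = rightTranslate a (rightTranslate b f) := by
    intro a b; ext x; simp [add_assoc]
  let H : AddSubgroup (Fin d → ℝ) :=
    { carrier := {k | rightTranslate k f - f ∈ U}
      zero_mem' := by
        have : rightTranslate (0 : Fin d → ℝ) f = f := by ext x; simp
        simp [this]
      add_mem' := by
        intro a b ha hb
        have : rightTranslate (a + b) f - f =
            rightTranslate a (rightTranslate b f - f) + (rightTranslate a f - f) := by
          rw [tr_add, map_sub]; abel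
        simp only [Set.mem_ofPred_eq, this]
        exact add_mem (hUt _ hb a) ha
      neg_mem' := by
        intro a ha
        have : rightTranslate (-a) f - f = - rightTranslate (-a) (rightTranslate a f - f) := by
          ext x; simp
        simp only [Set.mem_ofPred_eq, this]
        exact neg_mem (hUt _ ha _) }
  have hHc : IsClosed (H : Set (Fin d → ℝ)) := by
    have hc : Continuous fun k => rightTranslate k f - f := by
      refine continuous_pi fun x => ?_
      exact (hf.comp (continuous_const.add continuous_id)).sub continuous_const
    exact (Submodule.closed_of_finiteDimensional U).preimage hc
  have hg : ∀ p, g p ∈ H := fun p =>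
    Submodule.mem_iSup_of_mem p (self_mem_translateSpan _)
  have hsingle : ∀ (j : Fin d) (t : ℝ), Pi.single j t ∈ H := by
    intro j
    let φ : ℝ →+ (Fin d → ℝ) := AddMonoidHom.single (fun _ => ℝ) j
    have hdense : Dense (AddSubgroup.closure {(1 : ℝ), √2} : Set ℝ) := by
      rw [dense_addSubgroupClosure_pair_iff]
      simpa using irrational_sqrt_two.inv
    have hle : AddSubgroup.closure {(1 : ℝ), √2} ≤ H.comap φ := by
      rw [AddSubgroup.closure_le]
      rintro x (rfl | rfl)
      · exact hg (j, true)
      · exact hg (j, false)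
    have hcl : IsClosed (H.comap φ : Set ℝ) := hHc.preimage (continuous_single j)
    intro t
    exact (hcl.closure_subset_iff.2 hle) (hdense t)
  have hall : ∀ k, k ∈ H := by
    intro k
    rw [← Finset.univ_sum_single k]
    exact sum_mem fun j _ => hsingle j _
  have hle : translateSpan f ≤ U ⊔ Submodule.span ℂ {f} := by
    refine Submodule.span_le.2 ?_
    rintro _ ⟨k, rfl⟩
    have hk : rightTranslate k f - f ∈ U := hall k
    simpa using Submodule.add_mem_sup hk (Submodule.mem_span_singleton_self f)
  exact Submodule.finiteDimensional_of_le hle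

lemma finiteDimensional_translateSpan_of_sum_mem {d : ℕ} (m : ℕ)
    (c : Fin m → Matrix (Fin d) (Fin d) ℝ)
    (hc : ∀ i, IsUnit (c i)) (hcij : ∀ i j, i ≠ j → IsUnit (c i - c j))
    (f : Fin m → (Fin d → ℝ) → ℂ) (hf : ∀ i, Continuous (f i))
    (W : Submodule ℂ ((Fin d → ℝ) → ℂ)) [FiniteDimensional ℂ W]
    (hmem : ∀ y : Fin d → ℝ, (fun x => ∑ i, f i (x + (c i).mulVec y)) ∈ W) (i : Fin m) :
    FiniteDimensional ℂ (translateSpan (f i)) := by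
  induction m generalizing W with
  | zero => exact i.elim0
  | succ m ih =>
    have surj : ∀ A : Matrix (Fin d) (Fin d) ℝ, IsUnit A → ∀ k, ∃ h, A.mulVec h = k :=
      fun A hA => Matrix.mulVec_surjective_iff_isUnit.2 hA
    have hinit : ∀ i : Fin m, FiniteDimensional ℂ (translateSpan (f i.castSucc)) := by
      intro i
      refine finiteDimensional_translateSpan_of_sub (hf _) fun k => ?_
      obtain ⟨h, rfl⟩ := surj (c i.castSucc - c (Fin.last m))
        (hcij _ _ (Fin.castSucc_lt_last i).ne) k
      refine ih (fun i => c i.castSucc) (fun i => hc _) (fun i j hij => hcij _ _ (by simpa using hij))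
        (fun i => rightTranslate ((c i.castSucc - c (Fin.last m)).mulVec h) (f i.castSucc)
          - f i.castSucc)
        (fun i => ?_) (W.map (rightTranslate (-(c (Fin.last m)).mulVec h)) ⊔ W) ?_ i
      · exact ((hf _).comp (continuous_id.add continuous_const)).sub (hf _)
      · intro y
        convert Submodule.add_mem_sup (Submodule.mem_map_of_mem
          (f := rightTranslate (-(c (Fin.last m)).mulVec h)) (hmem (y + h))) (neg_mem (hmem y)) using 1
        ext x
        simp only [Fin.sum_univ_castSucc, Pi.add_apply, Pi.neg_apply, rightTranslate_apply,
          Pi.sub_apply, Finset.sum_sub_distrib, Matrix.mulVec_add, Matrix.sub_mulVec]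
        have e : x + -(c (Fin.last m)).mulVec h +
            ((c (Fin.last m)).mulVec y + (c (Fin.last m)).mulVec h)
            = x + (c (Fin.last m)).mulVec y := by abel
        have e' : ∀ i : Fin m, x + -(c (Fin.last m)).mulVec h +
            ((c i.castSucc).mulVec y + (c i.castSucc).mulVec h)
            = x + (c i.castSucc).mulVec y +
              ((c i.castSucc).mulVec h - (c (Fin.last m)).mulVec h) := fun i => by abel
        simp only [e, e']
        ring
    refine Fin.lastCases ?_ hinit i
    have hle : translateSpan (f (Fin.last m)) ≤ W ⊔ ⨆ i : Fin m, translateSpan (f i.castSucc) := by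
      refine Submodule.span_le.2 ?_
      rintro _ ⟨k, rfl⟩
      obtain ⟨y, rfl⟩ := surj _ (hc (Fin.last m)) k
      have hs : ∑ i : Fin m, rightTranslate ((c i.castSucc).mulVec y) (f i.castSucc) ∈
          ⨆ i : Fin m, translateSpan (f i.castSucc) :=
        sum_mem fun i _ => Submodule.mem_iSup_of_mem i (rightTranslate_mem_translateSpan _ _)
      have hlast : rightTranslate ((c (Fin.last m)).mulVec y) (f (Fin.last m)) =
          (fun x => ∑ i, f i (x + (c i).mulVec y)) +
            -∑ i : Fin m, rightTranslate ((c i.castSucc).mulVec y) (f i.castSucc) := by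
        ext x
        simp [Fin.sum_univ_castSucc]
      change rightTranslate _ _ ∈ _
      rw [hlast]
      exact Submodule.add_mem_sup (hmem y) (neg_mem hs)
    exact Submodule.finiteDimensional_of_le hle

/-- A continuous function whose translates span a finite-dimensional space belongs to the algebra
of exponential polynomials. -/
lemma mem_expPolyAlgebra_of_finiteDimensional_translateSpan {d : ℕ} {f : (Fin d → ℝ) → ℂ}
    (hf : Continuous f) [FiniteDimensional ℂ (translateSpan f)] : f ∈ expPolyAlgebra d := by
  let V := translateSpan f
  let e : V ≃L[ℂ] (Fin (Module.finrank ℂ V) → ℂ) :=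
    (Module.finBasis ℂ V).equivFun.toContinuousLinearEquiv
  let R : (Fin d → ℝ) → V →ₗ[ℂ] V := fun h =>
    (rightTranslate h).restrict fun g hg => rightTranslate_mem_of_mem_translateSpan hg h
  have hR0 : R 0 = LinearMap.id := by
    ext g x
    simp [R]
  have hRadd : ∀ a b, R (a + b) = R a ∘ₗ R b := by
    intro a b
    ext g x
    simp [R, add_assoc]
  let S : (Fin d → ℝ) → (Fin (Module.finrank ℂ V) → ℂ) →L[ℂ] (Fin (Module.finrank ℂ V) → ℂ) :=
    fun h => (e.toLinearMap ∘ₗ R h ∘ₗ e.symm.toLinearMap).toContinuousLinearMap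
  have hS : ∀ h w, S h w = e (R h (e.symm w)) := fun _ _ => rfl
  have hS0 : S 0 = 1 := by
    ext1 w
    simp [hS, hR0]
  have hSadd : ∀ a b, S (a + b) = S a * S b := by
    intro a b
    refine ContinuousLinearMap.ext fun w => ?_
    simp [hS, hRadd]
  have hScont : Continuous S := by
    refine continuous_clm_apply.2 fun w => e.continuous.comp ?_
    refine Continuous.subtype_mk (continuous_pi fun x => ?_) _
    exact (continuous_of_mem_translateSpan hf (e.symm w).2).comp
      (continuous_const.add continuous_id)
  have hmem : ∀ (s : Finset (Fin d)) (l : (Fin (Module.finrank ℂ V) → ℂ) →L[ℂ] ℂ)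
      (v : Fin (Module.finrank ℂ V) → ℂ),
      (fun x : Fin d → ℝ => l (S (∑ j ∈ s, Pi.single j (x j)) v)) ∈ expPolyAlgebra d := by
    intro s
    induction s using Finset.induction_on with
    | empty => exact fun l v => (expPolyAlgebra d).algebraMap_mem (l (S 0 v))
    | insert j s hj ih =>
      intro l v
      have hexpand : (fun x : Fin d → ℝ => l (S (∑ j ∈ insert j s, Pi.single j (x j)) v)) =
          ∑ i, (fun x : Fin d → ℝ => S (∑ j ∈ s, Pi.single j (x j)) v i) *
            (fun x : Fin d → ℝ => l (S (Pi.single j (x j)) (Pi.single i 1))) := by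
        ext x
        rw [Finset.sum_insert hj, hSadd, mul_apply_eq_comp,
          pi_eq_sum_univ' (S (∑ j ∈ s, Pi.single j (x j)) v)]
        simp
      rw [hexpand]
      refine sum_mem fun i _ => mul_mem (ih (ContinuousLinearMap.proj i) v) ?_
      refine coord_comp_one_parameter_group_mem j (T := fun t => S (Pi.single j t))
        (hScont.comp (continuous_single (A := fun _ => ℝ) j)) ?_ (fun s t => ?_) l _
      · simp [hS0]
      · rw [Pi.single_add, hSadd]
  let l : (Fin (Module.finrank ℂ V) → ℂ) →L[ℂ] ℂ :=
    (ContinuousLinearMap.proj 0).comp (V.subtypeL.comp e.symm.toContinuousLinearMap)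
  convert hmem Finset.univ l (e ⟨f, self_mem_translateSpan f⟩) with x
  simp [l, hS, R, Finset.univ_sum_single]

theorem stmt_0 {d m n : ℕ} (hd : 0 < d) (hm : 0 < m) (hn : 0 < n)
    (c : Fin m → Matrix (Fin d) (Fin d) ℝ)
    (hc : ∀ i, IsUnit (c i))
    (hcij : ∀ i j, i ≠ j → IsUnit (c i - c j))
    (f : Fin m → (Fin d → ℝ) → ℂ) (hf : ∀ i, Continuous (f i))
    (W : Submodule ℂ ((Fin d → ℝ) → ℂ)) (hW : Module.finrank ℂ W = n)
    (hmem : ∀ y : Fin d → ℝ, (fun x => ∑ i, f i (x + (c i).mulVec y)) ∈ W) :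
    ∀ i, IsExpPoly (f i) := by
  have : FiniteDimensional ℂ W := Module.finite_of_finrank_pos (hW ▸ hn)
  intro i
  have := finiteDimensional_translateSpan_of_sum_mem m c hc hcij f hf W hmem i
  exact IsExpPoly.of_mem_expPolyAlgebra
    (mem_expPolyAlgebra_of_finiteDimensional_translateSpan (hf i))
end

section
/- Let d, m ≥ 1 and r, s ≥ 0 be integers and let c_1, …, c_m be invertible real d×d matrices such that c_i − c_j is invertible whenever i ≠ j. Let f_1, …, f_m : ℝ^d → ℂ be continuous, and for each multi-index α ∈ ℕ^d with |α| ≤ r and each multi-index β ∈ ℕ^d with |β| ≤ s let a_α : ℝ^d → ℂ and b_β : ℝ^d → ℂ be continuous functions. If ∑_{i=1}^m f_i(x + c_i y) = ∑_{|α| ≤ r} x^α a_α(y) + ∑_{|β| ≤ s} b_β(x) y^β holds for all x, y ∈ ℝ^d, then every f_i is a polynomial function. -/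
/-- `f : ℝ^d → ℂ` is a polynomial function: it agrees with the evaluation of a
multivariate polynomial in `d` variables with complex coefficients. -/
def IsPolyFun {d : ℕ} (f : (Fin d → ℝ) → ℂ) : Prop :=
  ∃ p : MvPolynomial (Fin d) ℂ,
    ∀ x : Fin d → ℝ, f x = MvPolynomial.eval (fun j => (x j : ℂ)) p

open Finset

section ForwardDifference

variable {V W G : Type*} [AddCommGroup V] [AddCommGroup W] [AddCommGroup G]

theorem fwdDiff_iter_comp_addMonoidHom (φ : V →+ W) (g : W → G) (p : V) (n : ℕ) :
    (fwdDiff p)^[n] (g ∘ φ) = ((fwdDiff (φ p))^[n] g) ∘ φ := by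
  ext x
  simp [fwdDiff_iter_eq_sum_shift]

theorem fwdDiff_iter_zero_fun (p : V) (n : ℕ) : (fwdDiff p)^[n] (0 : V → G) = 0 := by
  ext x
  simp [fwdDiff_iter_eq_sum_shift]

theorem fwdDiff_commute (p q : V) : Function.Commute (fwdDiff (G := G) p) (fwdDiff q) := by
  intro F
  ext x
  simp only [fwdDiff, add_right_comm x p q]
  abel

/-- A summand of a sum of functions `g i ∘ φ i` is annihilated by iterated differences if the sum
is, provided that every other summand can be annihilated by a single difference. -/
theorem fwdDiff_iter_eq_zero_of_sum_comp {ι : Type*} [DecidableEq ι] (φ : ι → V →+ W) (i : ι)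
    (hφ : ∀ j, j ≠ i → ∀ w, ∃ p, φ j p = 0 ∧ φ i p = w) (k l : ℕ) (T : Finset ι) (hT : i ∉ T)
    (g : ι → W → G) (R : V → G) (hg : ∑ j ∈ insert i T, g j ∘ φ j = R)
    (hR : ∀ w, ∃ p q, φ i p = w ∧ φ i q = w ∧ (fwdDiff p)^[k] ((fwdDiff q)^[l] R) = 0) (w : W) :
    (fwdDiff w)^[k + l + #T] (g i) = 0 := by
  have surj : Function.Surjective (φ i) := fun w ↦ by
    obtain ⟨p, _, hp, _⟩ := hR w
    exact ⟨p, hp⟩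
  induction T using Finset.induction_on generalizing g R with
  | empty =>
    obtain ⟨p, q, hp, hq, hpq⟩ := hR w
    simp only [insert_empty_eq, sum_singleton] at hg
    rw [← hg, fwdDiff_iter_comp_addMonoidHom, fwdDiff_iter_comp_addMonoidHom, hp, hq,
      ← Function.iterate_add_apply] at hpq
    exact surj.injective_comp_right (by simpa using hpq)
  | insert j T hj ih =>
    simp only [mem_insert, not_or] at hT
    obtain ⟨v, hv0, hvw⟩ := hφ j (Ne.symm hT.1) w
    rw [card_insert_of_notMem hj, ← add_assoc, Function.iterate_succ_apply]
    have key := ih hT.2 (fun a ↦ fwdDiff (φ a v) (g a)) (fwdDiff v R) ?_ ?_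
    · simpa only [hvw] using key
    · have hcomp (a : ι) : fwdDiff (φ a v) (g a) ∘ φ a = fwdDiff v (g a ∘ φ a) :=
        (fwdDiff_iter_comp_addMonoidHom (φ a) (g a) v 1).symm
      have hzero : fwdDiff v (g j ∘ φ j) = 0 := by
        ext x
        simp [fwdDiff, hv0]
      have hjT : j ∉ insert i T := by simp [Ne.symm hT.1, hj]
      rw [← hg, Finset.insert_comm, sum_insert hjT, fwdDiff_add, hzero, zero_add]
      simp only [hcomp]
      exact (fwdDiff_finsetSum _ _ _).symm
    · intro u
      obtain ⟨p, q, hp, hq, hpq⟩ := hR u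
      refine ⟨p, q, hp, hq, ?_⟩
      rw [(fwdDiff_commute q v).iterate_left l R, (fwdDiff_commute p v).iterate_left k, hpq]
      exact fwdDiff_iter_zero_fun v 1

end ForwardDifference

section Polynomial

open Polynomial

theorem fwdDiff_iter_sum_monomial_mul_eq_zero {V κ : Type*} [AddCommGroup V] {d n : ℕ}
    (T : Finset κ) (e : κ → Fin d → ℕ) (he : ∀ α ∈ T, ∑ j, e α j < n)
    (π σ : V →+ (Fin d → ℝ)) (a : κ → (Fin d → ℝ) → ℂ) (h : V) (hσ : σ h = 0) :
    (fwdDiff h)^[n] (fun p ↦ ∑ α ∈ T, (∏ j, (π p j : ℂ) ^ e α j) * a α (σ p)) = 0 := by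
  rcases n.eq_zero_or_pos with rfl | hn
  · ext p
    simp [sum_eq_zero fun α hα ↦ absurd (he α hα) (Nat.not_lt_zero _)]
  ext p
  let P : ℂ[X] := ∑ α ∈ T, (∏ j, (C (π p j : ℂ) + C (π h j : ℂ) * X) ^ e α j) * C (a α (σ p))
  have hP : P.natDegree < n := by
    refine (Nat.lt_iff_le_pred hn).2 (natDegree_sum_le_of_forall_le _ _ fun α hα ↦ ?_)
    refine (natDegree_mul_C_le _ _).trans ((natDegree_prod_le _ _).trans ?_)
    refine (sum_le_sum fun j _ ↦ ?_).trans (Nat.le_pred_of_lt (he α hα))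
    refine (natDegree_pow_le.trans (Nat.mul_le_mul_left (e α j) (m := 1) ?_)).trans (by simp)
    compute_degree
  have := congrFun (fwdDiff_iter_eq_zero_of_degree_lt hP) 0
  rw [fwdDiff_iter_eq_sum_shift] at this ⊢
  refine Eq.trans (sum_congr rfl fun k _ ↦ ?_) this
  have hval : π (p + k • h) = fun j ↦ π p j + k * π h j := by
    ext j
    simp
  have hval' : σ (p + k • h) = σ p := by simp [hσ]
  simp only [P, eval_finsetSum, eval_prod, eval_mul, eval_pow, eval_add, eval_C, eval_X, hval,
    hval', zero_add, nsmul_one, Complex.ofReal_add, Complex.ofReal_mul,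
    Complex.ofReal_natCast, mul_comm (k : ℂ)]

/-- Along an arithmetic progression, a function whose `N`-th difference vanishes is given by a
polynomial of degree less than `N`. -/
theorem exists_polynomial_eval_nat_of_fwdDiff_iter_eq_zero {V : Type*} [AddCommGroup V] {N : ℕ}
    {g : V → ℂ} {h : V} (hg : (fwdDiff h)^[N] g = 0) (y : V) :
    ∃ Q : ℂ[X], Q.degree < N ∧ ∀ k : ℕ, Q.eval (k : ℂ) = g (y + k • h) := by
  refine ⟨∑ k ∈ range N, C ((fwdDiff h)^[k] g y / k.factorial) * descPochhammer ℂ k, ?_,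
    fun n ↦ ?_⟩
  · rw [← mem_degreeLT]
    refine Submodule.sum_mem _ fun k hk ↦ ?_
    rw [mem_degreeLT]
    refine degree_le_natDegree.trans_lt ((Nat.cast_le.2 (natDegree_C_mul_le _ _)).trans_lt ?_)
    rw [descPochhammer_natDegree]
    exact_mod_cast mem_range.1 hk
  · have hzero (k : ℕ) (hk : N ≤ k) : (fwdDiff h)^[k] g = 0 := by
      obtain ⟨l, rfl⟩ := Nat.exists_eq_add_of_le' hk
      rw [Function.iterate_add_apply, hg, fwdDiff_iter_zero_fun]
    have hterm (k : ℕ) : n.choose k • (fwdDiff h)^[k] g y =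
        ((fwdDiff h)^[k] g y / k.factorial) * (descPochhammer ℂ k).eval (n : ℂ) := by
      rw [nsmul_eq_mul, Nat.cast_choose_eq_descPochhammer_div]
      ring
    rw [shift_eq_sum_fwdDiff_iter h g, eval_finsetSum]
    simp only [eval_mul, eval_C, ← hterm]
    rcases le_total N (n + 1) with hN | hN
    · refine sum_subset (range_subset_range.2 hN) fun k _ hk ↦ ?_
      rw [hzero k (by simpa using hk)]
      simp
    · refine (sum_subset (range_subset_range.2 hN) fun k _ hk ↦ ?_).symm
      rw [Nat.choose_eq_zero_of_lt (by simpa using hk), zero_smul]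

/-- A continuous function on the line with vanishing `N`-th differences is its own Lagrange
interpolant at the nodes `0, …, N - 1`. -/
theorem eq_eval_interpolate_of_fwdDiff_iter_eq_zero {g : ℝ → ℂ} (hc : Continuous g) {N : ℕ}
    (hg : ∀ t, (fwdDiff t)^[N] g = 0) (x : ℝ) :
    g x = (Lagrange.interpolate (range N) (fun k : ℕ ↦ (k : ℂ)) (fun k ↦ g k)).eval (x : ℂ) := by
  set p := Lagrange.interpolate (range N) (fun k : ℕ ↦ (k : ℂ)) (fun k ↦ g k)
  have inj : Set.InjOn (fun k : ℕ ↦ (k : ℂ)) (range N) := Nat.cast_injective.injOn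
  have hp : Continuous fun x : ℝ ↦ p.eval (x : ℂ) := p.continuous.comp Complex.continuous_ofReal
  refine congrFun (Rat.denseRange_cast.equalizer hc hp (funext fun q ↦ ?_)) x
  have hn : (q.den : ℂ) ≠ 0 := by exact_mod_cast q.den_nz
  have hn' : (q.den : ℝ) ≠ 0 := by exact_mod_cast q.den_nz
  set M := q.num.natAbs
  obtain ⟨Q, hQ, hQe⟩ := exists_polynomial_eval_nat_of_fwdDiff_iter_eq_zero
    (hg (1 / q.den)) (-(M : ℝ))
  have hQp : Q = p.comp (C (1 / (q.den : ℂ)) * X - C (M : ℂ)) := by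
    refine eq_of_degrees_lt_of_eval_index_eq (s := range N)
      (v := fun j : ℕ ↦ ((q.den * (M + j) : ℕ) : ℂ)) ?_ (by simpa using hQ) ?_ fun j hj ↦ ?_
    · intro j _ k _ hjk
      have := Nat.eq_of_mul_eq_mul_left q.den_pos (Nat.cast_injective (R := ℂ) hjk)
      omega
    · have hpd : p.degree < #(range N) := Lagrange.degree_interpolate_lt _ inj
      rw [card_range] at hpd ⊢
      rcases eq_or_ne p 0 with h0 | h0
      · simp [h0]
      refine degree_le_natDegree.trans_lt ?_
      rw [degree_eq_natDegree h0] at hpd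
      refine lt_of_le_of_lt ?_ hpd
      refine Nat.cast_le.2 (natDegree_comp_le.trans ?_)
      refine (Nat.mul_le_mul_left _ (m := 1) ?_).trans (by simp)
      compute_degree
    · have hj' : p.eval (j : ℂ) = g j := Lagrange.eval_interpolate_at_node _ inj hj
      rw [hQe, eval_comp]
      simp only [eval_sub, eval_mul, eval_C, eval_X]
      rw [show 1 / (q.den : ℂ) * ((q.den * (M + j) : ℕ) : ℂ) - M = j by
        push_cast; field_simp; ring, hj']
      congr 1
      simp only [nsmul_eq_mul]
      push_cast
      field_simp
      ring
  have hnum : 0 ≤ q.num + M * q.den := by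
    have h1 : -(M : ℤ) ≤ q.num := by omega
    have h2 : (1 : ℤ) ≤ q.den := by exact_mod_cast q.den_pos
    nlinarith [Int.natCast_nonneg M]
  obtain ⟨k, hk⟩ := Int.eq_ofNat_of_zero_le hnum
  have hkR : (k : ℝ) = (q : ℝ) * q.den + M * q.den := by
    have h1 : (q : ℝ) * q.den = q.num := by exact_mod_cast q.mul_den_eq_num
    rw [h1]
    exact_mod_cast hk.symm
  have hx : (q : ℝ) = -(M : ℝ) + k • (1 / (q.den : ℝ)) := by
    rw [nsmul_eq_mul, hkR]
    field_simp
    ring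
  have hkC : (k : ℂ) = ((q : ℝ) : ℂ) * q.den + M * q.den := by
    exact_mod_cast congrArg Complex.ofReal hkR
  have := hQe k
  rw [← hx, hQp, eval_comp] at this
  simp only [Function.comp_apply]
  rw [← this]
  congr 1
  simp only [eval_sub, eval_mul, eval_C, eval_X]
  rw [hkC]
  field_simp
  ring

end Polynomial

section IsPolyFun

variable {d : ℕ}

theorem IsPolyFun.mul {f g : (Fin d → ℝ) → ℂ} (hf : IsPolyFun f) (hg : IsPolyFun g) :
    IsPolyFun fun x ↦ f x * g x := by
  obtain ⟨p, hp⟩ := hf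
  obtain ⟨q, hq⟩ := hg
  exact ⟨p * q, fun x ↦ by simp [hp, hq]⟩

theorem IsPolyFun.sum {κ : Type*} (T : Finset κ) {f : κ → (Fin d → ℝ) → ℂ}
    (hf : ∀ k, IsPolyFun (f k)) : IsPolyFun fun x ↦ ∑ k ∈ T, f k x := by
  choose p hp using hf
  exact ⟨∑ k ∈ T, p k, fun x ↦ by simp [hp]⟩

theorem isPolyFun_eval_coord (p : Polynomial ℂ) (j : Fin d) :
    IsPolyFun fun x ↦ p.eval (x j : ℂ) :=
  ⟨Polynomial.aeval (MvPolynomial.X j) p, fun x ↦ by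
    rw [Polynomial.aeval_def, Polynomial.hom_eval₂]
    simp [Polynomial.eval, Polynomial.eval₂_eq_sum_range]⟩

/-- A continuous function on `ℝ^d` whose `N`-th differences vanish is a polynomial function. -/
theorem IsPolyFun.of_fwdDiff_iter_eq_zero {f : (Fin d → ℝ) → ℂ} (hc : Continuous f) {N : ℕ}
    (hf : ∀ w, (fwdDiff w)^[N] f = 0) : IsPolyFun f := by
  suffices h : ∀ (S : Finset (Fin d)) (z : Fin d → ℝ), IsPolyFun fun x ↦ f (S.piecewise x z) by
    simpa using h univ 0
  intro S
  induction S using Finset.induction_on with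
  | empty => exact fun z ↦ ⟨MvPolynomial.C (f z), fun x ↦ by simp⟩
  | insert j S hj ih =>
    intro z
    have key (u : Fin d → ℝ) (t : ℝ) : f (Function.update u j t) = ∑ k ∈ range N,
        (Lagrange.basis (range N) (fun k : ℕ ↦ (k : ℂ)) k).eval (t : ℂ) *
          f (Function.update u j k) := by
      have hline (t : ℝ) : Function.update u j t =
          Function.update u j 0 + AddMonoidHom.single (fun _ : Fin d ↦ ℝ) j t := by
        ext l
        rcases eq_or_ne l j with rfl | hl <;> simp [*]
      have := eq_eval_interpolate_of_fwdDiff_iter_eq_zero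
        (g := fun t ↦ f (Function.update u j t)) (N := N) (by fun_prop) (fun s ↦ ?_) t
      · simpa [Lagrange.interpolate_apply, Polynomial.eval_finsetSum, mul_comm] using this
      · ext x
        have h0 := congrFun (hf (AddMonoidHom.single (fun _ : Fin d ↦ ℝ) j s))
          (Function.update u j x)
        rw [fwdDiff_iter_eq_sum_shift] at h0 ⊢
        refine Eq.trans (sum_congr rfl fun k _ ↦ ?_) h0
        rw [hline, hline x, map_add, map_nsmul, add_assoc]
    have hpw (x : Fin d → ℝ) : f ((insert j S).piecewise x z) = ∑ k ∈ range N,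
        (Lagrange.basis (range N) (fun k : ℕ ↦ (k : ℂ)) k).eval (x j : ℂ) *
          f (S.piecewise x (Function.update z j k)) := by
      rw [Finset.piecewise_insert, key]
      simp only [S.update_piecewise_of_notMem _ _ hj]
    simp only [hpw]
    exact IsPolyFun.sum _ fun k ↦ (isPolyFun_eval_coord _ j).mul (ih _)

end IsPolyFun

theorem stmt_2 {d m : ℕ} (hd : 0 < d) (hm : 0 < m) (r s : ℕ)
    (c : Fin m → Matrix (Fin d) (Fin d) ℝ)
    (hc : ∀ i, IsUnit (c i))
    (hcij : ∀ i j, i ≠ j → IsUnit (c i - c j))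
    (f : Fin m → (Fin d → ℝ) → ℂ) (hf : ∀ i, Continuous (f i))
    (a : (Fin d → Fin (r + 1)) → (Fin d → ℝ) → ℂ)
    (b : (Fin d → Fin (s + 1)) → (Fin d → ℝ) → ℂ)
    (ha : ∀ α, Continuous (a α)) (hb : ∀ β, Continuous (b β))
    (heq : ∀ x y : Fin d → ℝ,
      ∑ i, f i (x + (c i).mulVec y) =
        (∑ α ∈ Finset.univ.filter (fun α : Fin d → Fin (r + 1) => ∑ j, (α j : ℕ) ≤ r),
            (∏ j, (x j : ℂ) ^ (α j : ℕ)) * a α y)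
        + ∑ β ∈ Finset.univ.filter (fun β : Fin d → Fin (s + 1) => ∑ j, (β j : ℕ) ≤ s),
            b β x * ∏ j, (y j : ℂ) ^ (β j : ℕ)) :
    ∀ i, IsPolyFun (f i) := by
  classical
  intro i
  let φ (l : Fin m) : (Fin d → ℝ) × (Fin d → ℝ) →+ (Fin d → ℝ) :=
    (AddMonoidHom.id _).coprod (c l).mulVecLin.toAddMonoidHom
  have hφ (l : Fin m) (p) : φ l p = p.1 + (c l).mulVec p.2 := rfl
  have hsurj {A : Matrix (Fin d) (Fin d) ℝ} (hA : IsUnit A) (w : Fin d → ℝ) :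
      ∃ v, A.mulVec v = w := Matrix.mulVec_surjective_iff_isUnit.2 hA w
  refine IsPolyFun.of_fwdDiff_iter_eq_zero (hf i) fun w ↦
    fwdDiff_iter_eq_zero_of_sum_comp φ i (fun j hj w ↦ ?_) (r + 1) (s + 1) (univ.erase i)
      (notMem_erase i univ) f _ rfl (fun w ↦ ?_) w
  · obtain ⟨v, hv⟩ := hsurj (hcij i j hj.symm) w
    refine ⟨(-(c j).mulVec v, v), by simp [hφ], ?_⟩
    rw [hφ, ← hv, Matrix.sub_mulVec]
    exact neg_add_eq_sub _ _
  · obtain ⟨v, hv⟩ := hsurj (hc i) w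
    refine ⟨(w, 0), (0, v), by simp [hφ], by simp [hφ, hv], ?_⟩
    obtain ⟨A, hA, hA'⟩ : ∃ A : (Fin d → ℝ) × (Fin d → ℝ) → ℂ, (fwdDiff (w, 0))^[r + 1] A = 0 ∧
        ∀ p, A p = ∑ α ∈ univ.filter (fun α : Fin d → Fin (r + 1) ↦ ∑ j, (α j : ℕ) ≤ r),
          (∏ j, (p.1 j : ℂ) ^ (α j : ℕ)) * a α p.2 :=
      have h := fwdDiff_iter_sum_monomial_mul_eq_zero (n := r + 1)
        (univ.filter fun α : Fin d → Fin (r + 1) ↦ ∑ j, (α j : ℕ) ≤ r) (fun α j ↦ (α j : ℕ))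
        (fun α hα ↦ Nat.lt_succ_of_le (mem_filter.1 hα).2)
        (AddMonoidHom.fst (Fin d → ℝ) (Fin d → ℝ)) (AddMonoidHom.snd _ _) a (w, 0) rfl
      ⟨_, h, fun _ ↦ rfl⟩
    obtain ⟨B, hB, hB'⟩ : ∃ B : (Fin d → ℝ) × (Fin d → ℝ) → ℂ, (fwdDiff (0, v))^[s + 1] B = 0 ∧
        ∀ p, B p = ∑ β ∈ univ.filter (fun β : Fin d → Fin (s + 1) ↦ ∑ j, (β j : ℕ) ≤ s),
          (∏ j, (p.2 j : ℂ) ^ (β j : ℕ)) * b β p.1 :=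
      have h := fwdDiff_iter_sum_monomial_mul_eq_zero (n := s + 1)
        (univ.filter fun β : Fin d → Fin (s + 1) ↦ ∑ j, (β j : ℕ) ≤ s) (fun β j ↦ (β j : ℕ))
        (fun β hβ ↦ Nat.lt_succ_of_le (mem_filter.1 hβ).2)
        (AddMonoidHom.snd (Fin d → ℝ) (Fin d → ℝ)) (AddMonoidHom.fst _ _) b (0, v) rfl
      ⟨_, h, fun _ ↦ rfl⟩
    have hsum : ∑ j ∈ insert i (univ.erase i), f j ∘ φ j = A + B := by
      rw [insert_erase (mem_univ i)]
      ext p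
      simp only [Finset.sum_apply, Function.comp_apply, Pi.add_apply, hφ, hA', hB', heq p.1 p.2,
        mul_comm (b _ p.1)]
    rw [hsum, fwdDiff_iter_add, hB, add_zero, (fwdDiff_commute _ _).iterate_iterate _ _ A, hA,
      fwdDiff_iter_zero_fun]
end

section
/- Let d, m ≥ 1 be integers and let b_1, …, b_m, c_1, …, c_m be invertible real d×d matrices such that b_i^{-1} c_i − b_j^{-1} c_j is invertible whenever i ≠ j. Let f_1, …, f_m, P, Q : ℝ^d → ℂ be continuous functions satisfying ∑_{i=1}^m f_i(b_i x + c_i y) = P(x) + Q(y) for all x, y ∈ ℝ^d. Then P and Q are polynomial functions of total degree at most m. -/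
/-- `f : ℝ^d → ℂ` is a polynomial function of total degree at most `m`. -/
def IsPolyFunOfDegLE {d : ℕ} (f : (Fin d → ℝ) → ℂ) (m : ℕ) : Prop :=
  ∃ p : MvPolynomial (Fin d) ℂ, p.totalDegree ≤ m ∧
    ∀ x : Fin d → ℝ, f x = MvPolynomial.eval (fun j => (x j : ℂ)) p

open AddMonoidAlgebra in
/-- The linear extension of `f : V → ℂ` to the group algebra of `V`. -/
noncomputable def groupAlgebraExtend {V : Type*} (f : V → ℂ) :
    AddMonoidAlgebra ℂ V →ₗ[ℂ] ℂ :=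
  Finsupp.linearCombination ℂ f ∘ₗ (coeffLinearEquiv ℂ).toLinearMap

/-- The element `[u] - [0]` of the group algebra, acting on functions as the difference operator
with step `u`. -/
noncomputable def groupAlgebraDiff {V : Type*} [AddCommGroup V] (u : V) : AddMonoidAlgebra ℂ V :=
  AddMonoidAlgebra.single u 1 - 1

/-- All iterated differences of `f` of order `n` vanish. -/
def DifferencesVanish {V : Type*} [AddCommGroup V] (f : V → ℂ) (n : ℕ) : Prop :=
  ∀ (r : AddMonoidAlgebra ℂ V) (s : Multiset V), s.card = n →
    groupAlgebraExtend f (r * (s.map groupAlgebraDiff).prod) = 0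

@[simp]
lemma groupAlgebraExtend_single {V : Type*} (f : V → ℂ) (v : V) (a : ℂ) :
    groupAlgebraExtend f (AddMonoidAlgebra.single v a) = a * f v := by
  simp [groupAlgebraExtend, AddMonoidAlgebra.coeffLinearEquiv]

lemma groupAlgebraExtend_mapDomain {V W : Type*} [AddCommGroup V] [AddCommGroup W]
    (f : V → ℂ) (L : W →+ V) (r : AddMonoidAlgebra ℂ W) :
    groupAlgebraExtend f (AddMonoidAlgebra.mapDomainRingHom ℂ L r) =
      groupAlgebraExtend (f ∘ L) r := by
  induction r using AddMonoidAlgebra.induction_linear with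
  | zero => simp
  | add x y hx hy => simp only [map_add, hx, hy]
  | single v a => simp

lemma mapDomainRingHom_groupAlgebraDiff {V W : Type*} [AddCommGroup V] [AddCommGroup W]
    (L : W →+ V) (w : W) :
    AddMonoidAlgebra.mapDomainRingHom ℂ L (groupAlgebraDiff w) = groupAlgebraDiff (L w) := by
  rw [groupAlgebraDiff, map_sub, map_one]
  simp [groupAlgebraDiff]

lemma groupAlgebraDiff_zero {V : Type*} [AddCommGroup V] :
    groupAlgebraDiff (0 : V) = 0 := by
  simp [groupAlgebraDiff, AddMonoidAlgebra.one_def]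

lemma differencesVanish_of_sum_eq {V W : Type*} [AddCommGroup V] [AddCommGroup W] {m : ℕ}
    (L : Fin m → V × V →+ W) (hL : ∀ i u, ∃ v, L i (u, v) = 0)
    (f : Fin m → W → ℂ) (P Q : V → ℂ)
    (heq : ∀ x y, ∑ i, f i (L i (x, y)) = P x + Q y) :
    DifferencesVanish P (m + 1) := by
  intro r s hs
  obtain ⟨h, t, rfl, ht⟩ := Multiset.card_eq_succ_iff.mp hs
  obtain ⟨u, rfl⟩ : ∃ u : Fin m → V, t = Finset.univ.val.map u := by
    induction t using Quotient.inductionOn with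
    | h l =>
      obtain rfl : l.length = m := ht
      exact ⟨l.get, by simp⟩
  choose v hv using fun i => hL i (u i)
  have key (R : AddMonoidAlgebra ℂ (V × V)) :
      ∑ i, groupAlgebraExtend (f i ∘ L i) R =
        groupAlgebraExtend (P ∘ AddMonoidHom.fst V V) R +
          groupAlgebraExtend (Q ∘ AddMonoidHom.snd V V) R := by
    induction R using AddMonoidAlgebra.induction_linear with
    | zero => simp
    | add x y hx hy => simp only [map_add, Finset.sum_add_distrib, hx, hy]; ring
    | single v a => simp [← Finset.mul_sum, heq, mul_add]
  have := key (AddMonoidAlgebra.mapDomainRingHom ℂ (AddMonoidHom.inl V V) r *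
    (groupAlgebraDiff (h, 0) * ∏ i, groupAlgebraDiff (u i, v i)))
  simp only [← groupAlgebraExtend_mapDomain, map_mul, map_prod,
    mapDomainRingHom_groupAlgebraDiff] at this
  rw [Finset.sum_eq_zero] at this
  · simp only [AddMonoidHom.coe_snd, groupAlgebraDiff_zero, zero_mul, mul_zero, map_zero,
      add_zero, AddMonoidHom.coe_fst] at this
    rw [← RingHom.comp_apply, ← AddMonoidAlgebra.mapDomainRingHom_comp,
      AddMonoidHom.fst_comp_inl, AddMonoidAlgebra.mapDomainRingHom_id] at this
    rw [Multiset.map_cons, Multiset.prod_cons, Multiset.map_map]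
    exact this.symm
  · intro i _
    rw [Finset.prod_eq_zero (Finset.mem_univ i) (by rw [hv, groupAlgebraDiff_zero])]
    simp

lemma DifferencesVanish.of_le_card {V : Type*} [AddCommGroup V] {f : V → ℂ} {n : ℕ}
    (h : DifferencesVanish f n) (r : AddMonoidAlgebra ℂ V) (s : Multiset V) (hs : n ≤ s.card) :
    groupAlgebraExtend f (r * (s.map groupAlgebraDiff).prod) = 0 := by
  obtain ⟨t, s, rfl, ht⟩ : ∃ t s', s = t + s' ∧ t.card = n := by
    induction s using Quotient.inductionOn with
    | h l => exact ⟨l.take n, l.drop n, by simp, by simpa using hs⟩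
  rw [Multiset.map_add, Multiset.prod_add, mul_comm (Multiset.prod _), ← mul_assoc]
  exact h _ _ ht

/-- Newton's forward difference formula for a function with vanishing differences. -/
lemma DifferencesVanish.newton {V : Type*} [AddCommGroup V] {f : V → ℂ} {m d : ℕ}
    (h : DifferencesVanish f (m + 1)) (x : V) (w : Fin d → V) (n : Fin d → ℕ) :
    f (x + ∑ j, n j • w j) =
      ∑ k ∈ (Fintype.piFinset fun _ : Fin d => Finset.range (m + 1)) with ∑ j, k j ≤ m,
        groupAlgebraExtend f (AddMonoidAlgebra.single x 1 * ∏ j, groupAlgebraDiff (w j) ^ k j) *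
          ∏ j, ((n j).choose (k j) : ℂ) := by
  obtain ⟨M, hmM, hnM⟩ : ∃ M, m ≤ M ∧ ∀ j, n j ≤ M :=
    ⟨m + ∑ j, n j, by omega, fun j =>
      (Finset.single_le_sum (fun _ _ => Nat.zero_le _) (Finset.mem_univ j)).trans (by omega)⟩
  have hpow (j : Fin d) : (AddMonoidAlgebra.single (w j) (1 : ℂ)) ^ n j =
      ∑ k ∈ Finset.range (M + 1), ((n j).choose k : ℂ) • groupAlgebraDiff (w j) ^ k := by
    rw [← sub_add_cancel (AddMonoidAlgebra.single (w j) (1 : ℂ)) 1, add_pow]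
    refine Finset.sum_subset_zero_on_sdiff
      (Finset.range_subset_range.mpr (Nat.succ_le_succ (hnM j))) ?_ ?_
    · intro k hk
      simp only [Finset.mem_sdiff, Finset.mem_range] at hk
      rw [Nat.choose_eq_zero_of_lt (by omega)]
      simp
    · intro k _
      rw [one_pow, mul_one, mul_comm, Nat.cast_smul_eq_nsmul, nsmul_eq_mul]
      rfl
  have hsingle : AddMonoidAlgebra.single (x + ∑ j, n j • w j) (1 : ℂ) =
      AddMonoidAlgebra.single x 1 * ∏ j, (AddMonoidAlgebra.single (w j) (1 : ℂ)) ^ n j := by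
    have (s : Finset (Fin d)) : AddMonoidAlgebra.single (∑ j ∈ s, n j • w j) (1 : ℂ) =
        ∏ j ∈ s, (AddMonoidAlgebra.single (w j) (1 : ℂ)) ^ n j := by
      induction s using Finset.induction_on with
      | empty => simp [AddMonoidAlgebra.one_def]
      | insert a s ha ih =>
        rw [Finset.sum_insert ha, Finset.prod_insert ha, ← ih, AddMonoidAlgebra.single_pow,
          AddMonoidAlgebra.single_mul_single]
        simp
    rw [← this, AddMonoidAlgebra.single_mul_single, one_mul]
  have hf : f (x + ∑ j, n j • w j) =
      groupAlgebraExtend f (AddMonoidAlgebra.single (x + ∑ j, n j • w j) (1 : ℂ)) := by simp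
  rw [hf, hsingle, Finset.prod_congr rfl fun j _ => hpow j, Finset.prod_univ_sum, Finset.mul_sum,
    map_sum]
  symm
  refine Finset.sum_subset_zero_on_sdiff ?_ ?_ ?_
  · intro k hk
    simp only [Finset.mem_filter, Fintype.mem_piFinset, Finset.mem_range] at hk ⊢
    intro j
    have := hk.1 j
    omega
  · intro k hk
    simp only [Finset.mem_sdiff, Finset.mem_filter, Fintype.mem_piFinset, Finset.mem_range,
      not_and] at hk
    have hcard : m + 1 ≤ ∑ j, k j := by
      by_contra hlt
      refine hk.2 (fun j => ?_) (by omega)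
      have := Finset.single_le_sum (fun i _ => Nat.zero_le (k i)) (Finset.mem_univ j)
      omega
    have := h.of_le_card (AddMonoidAlgebra.single x 1)
      (∑ j, Multiset.replicate (k j) (w j)) (by simpa using hcard)
    rw [← Multiset.coe_mapAddMonoidHom, map_sum, Multiset.prod_sum] at this
    simp only [Multiset.coe_mapAddMonoidHom, Multiset.map_replicate, Multiset.prod_replicate]
      at this
    rw [Finset.prod_smul, mul_smul_comm, map_smul, this, smul_zero]
  · intro k _
    rw [Finset.prod_smul, mul_smul_comm, map_smul, smul_eq_mul, mul_comm]

/-- The polynomial `T ↦ T (T - 1) ⋯ (T - k + 1) / k!` evaluated at a multivariate polynomial. -/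
noncomputable def mvBinomial {d : ℕ} (T : MvPolynomial (Fin d) ℂ) (k : ℕ) :
    MvPolynomial (Fin d) ℂ :=
  MvPolynomial.C ((k.factorial : ℂ)⁻¹) * ∏ i ∈ Finset.range k, (T - MvPolynomial.C (i : ℂ))

lemma totalDegree_mvBinomial_le {d : ℕ} {T : MvPolynomial (Fin d) ℂ} (hT : T.totalDegree ≤ 1)
    (k : ℕ) : (mvBinomial T k).totalDegree ≤ k := by
  refine (MvPolynomial.totalDegree_mul _ _).trans ?_
  rw [MvPolynomial.totalDegree_C, zero_add]
  refine (MvPolynomial.totalDegree_finsetProd _ _).trans ?_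
  refine (Finset.sum_le_card_nsmul _ _ 1 fun i _ => ?_).trans (by simp)
  exact (MvPolynomial.totalDegree_sub_C_le _ _).trans hT

lemma eval_mvBinomial {d : ℕ} {T : MvPolynomial (Fin d) ℂ} {x : Fin d → ℂ} {n : ℕ}
    (hn : MvPolynomial.eval x T = n) (k : ℕ) :
    MvPolynomial.eval x (mvBinomial T k) = (n.choose k : ℂ) := by
  have hk : (k.factorial : ℂ) ≠ 0 := by exact_mod_cast k.factorial_ne_zero
  simp only [mvBinomial, map_mul, MvPolynomial.eval_C, map_prod, map_sub, hn]
  rw [← descPochhammer_eval_eq_prod_range, descPochhammer_eval_eq_descFactorial,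
    Nat.descFactorial_eq_factorial_mul_choose]
  push_cast
  field_simp

lemma DifferencesVanish.exists_polynomial {d m : ℕ} {f : (Fin d → ℝ) → ℂ}
    (h : DifferencesVanish f (m + 1)) (M N : Fin d → ℕ) (hN : ∀ j, N j ≠ 0) :
    ∃ p : MvPolynomial (Fin d) ℂ, p.totalDegree ≤ m ∧
      ∀ (x : Fin d → ℝ) (n : Fin d → ℕ), (∀ j, N j * (x j + M j) = n j) →
        f x = MvPolynomial.eval (fun j => (x j : ℂ)) p := by
  let T (j : Fin d) : MvPolynomial (Fin d) ℂ :=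
    MvPolynomial.C (N j : ℂ) * (MvPolynomial.X j + MvPolynomial.C (M j : ℂ))
  have hT (j : Fin d) : (T j).totalDegree ≤ 1 := by
    refine (MvPolynomial.totalDegree_mul _ _).trans ?_
    rw [MvPolynomial.totalDegree_C, zero_add]
    refine (MvPolynomial.totalDegree_add _ _).trans ?_
    rw [MvPolynomial.totalDegree_X, MvPolynomial.totalDegree_C]
    rfl
  let w (j : Fin d) : Fin d → ℝ := Pi.single j ((N j : ℝ)⁻¹)
  refine ⟨∑ k ∈ (Fintype.piFinset fun _ : Fin d => Finset.range (m + 1)) with ∑ j, k j ≤ m,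
    MvPolynomial.C (groupAlgebraExtend f (AddMonoidAlgebra.single (fun j => -(M j : ℝ)) 1 *
      ∏ j, groupAlgebraDiff (w j) ^ k j)) * ∏ j, mvBinomial (T j) (k j), ?_, ?_⟩
  · refine MvPolynomial.totalDegree_finsetSum_le fun k hk => ?_
    refine (MvPolynomial.totalDegree_mul _ _).trans ?_
    rw [MvPolynomial.totalDegree_C, zero_add]
    refine (MvPolynomial.totalDegree_finsetProd _ _).trans ?_
    exact (Finset.sum_le_sum fun j _ => totalDegree_mvBinomial_le (hT j) _).trans
      (Finset.mem_filter.mp hk).2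
  · intro x n hn
    have hx : x = (fun j => -(M j : ℝ)) + ∑ j, n j • w j := by
      ext i
      have : (N i : ℝ) ≠ 0 := by exact_mod_cast hN i
      simp only [w, Pi.add_apply, Finset.sum_apply, Pi.smul_apply, Pi.single_apply, smul_ite,
        smul_zero, Finset.sum_ite_eq, Finset.mem_univ, if_true]
      rw [nsmul_eq_mul, ← hn]
      field_simp
      ring
    have hTn (j : Fin d) : MvPolynomial.eval (fun j => (x j : ℂ)) (T j) = n j := by
      simp only [T, map_mul, map_add, MvPolynomial.eval_C, MvPolynomial.eval_X]
      exact_mod_cast congrArg ((↑) : ℝ → ℂ) (hn j)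
    conv_lhs => rw [hx, h.newton]
    simp only [map_sum, map_mul, map_prod, MvPolynomial.eval_C, eval_mvBinomial (hTn _)]

/-- Fréchet's theorem: a continuous function on `ℝ^d` whose differences of order `m + 1` vanish is
a polynomial of total degree at most `m`. -/
lemma DifferencesVanish.isPolyFunOfDegLE {d m : ℕ} {f : (Fin d → ℝ) → ℂ}
    (h : DifferencesVanish f (m + 1)) (hf : Continuous f) : IsPolyFunOfDegLE f m := by
  obtain ⟨p, hp, hfp⟩ := h.exists_polynomial (fun _ => 0) (fun _ => 1) (fun _ => one_ne_zero)
  refine ⟨p, hp, ?_⟩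
  have hdense : DenseRange (Pi.map fun (_ : Fin d) (q : ℚ) => (q : ℝ)) :=
    DenseRange.piMap fun _ => Rat.denseRange_cast
  have hcont : Continuous fun x : Fin d → ℝ => MvPolynomial.eval (fun j => (x j : ℂ)) p :=
    (MvPolynomial.continuous_eval p).comp (by fun_prop)
  refine congrFun (hdense.equalizer hf hcont (funext fun v => ?_))
  obtain ⟨q, -, hfq⟩ := h.exists_polynomial (fun j => (v j).num.natAbs) (fun j => (v j).den)
    (fun j => (v j).den_ne_zero)
  have hpq : p = q := by
    refine MvPolynomial.funext_set (fun _ => Set.range ((↑) : ℕ → ℂ))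
      (fun _ => Set.infinite_range_of_injective Nat.cast_injective) fun x hx => ?_
    choose a ha using fun j => hx j (Set.mem_univ j)
    obtain rfl : (fun j => ((a j : ℝ) : ℂ)) = x := funext fun j => by simpa using ha j
    rw [← hfp (fun j => a j) a (by simp),
      ← hfq (fun j => a j) (fun j => (v j).den * (a j + (v j).num.natAbs)) (by simp)]
  rw [hpq]
  refine hfq _ (fun j => ((v j).num + (v j).den * (v j).num.natAbs).toNat) fun j => ?_
  have hpos : 0 ≤ (v j).num + (v j).den * (v j).num.natAbs := by
    have h1 : (1 : ℤ) ≤ (v j).den := by exact_mod_cast (v j).den_pos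
    have h2 : -(v j).num ≤ (v j).num.natAbs := by omega
    nlinarith
  have hcast : ((((v j).num + (v j).den * (v j).num.natAbs).toNat : ℤ) : ℝ) =
      (v j).num + (v j).den * (v j).num.natAbs := by
    rw [Int.toNat_of_nonneg hpos]
    simp
  have hv : ((v j).den : ℝ) * (v j : ℝ) = (v j).num := by
    exact_mod_cast (v j).den_mul_eq_num
  rw [Int.cast_natCast] at hcast
  rw [hcast, mul_add, Pi.map_apply, hv]

theorem stmt_4 {d m : ℕ} (hd : 0 < d) (hm : 0 < m)
    (b c : Fin m → Matrix (Fin d) (Fin d) ℝ)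
    (hb : ∀ i, IsUnit (b i)) (hc : ∀ i, IsUnit (c i))
    (hij : ∀ i j, i ≠ j → IsUnit ((b i)⁻¹ * c i - (b j)⁻¹ * c j))
    (f : Fin m → (Fin d → ℝ) → ℂ) (hf : ∀ i, Continuous (f i))
    (P Q : (Fin d → ℝ) → ℂ) (hP : Continuous P) (hQ : Continuous Q)
    (heq : ∀ x y : Fin d → ℝ,
      ∑ i, f i ((b i).mulVec x + (c i).mulVec y) = P x + Q y) :
    IsPolyFunOfDegLE P m ∧ IsPolyFunOfDegLE Q m := by
  let L (i : Fin m) : (Fin d → ℝ) × (Fin d → ℝ) →+ (Fin d → ℝ) :=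
    ((b i).mulVecLin.coprod (c i).mulVecLin).toAddMonoidHom
  have hL (i : Fin m) (x y : Fin d → ℝ) :
      L i (x, y) = (b i).mulVec x + (c i).mulVec y := rfl
  have solve {A : Matrix (Fin d) (Fin d) ℝ} (hA : IsUnit A) (z : Fin d → ℝ) :
      ∃ v, A.mulVec v = -z :=
    (Matrix.mulVec_surjective_iff_isUnit.mpr hA) (-z)
  constructor
  · refine (differencesVanish_of_sum_eq L (fun i u => ?_) f P Q heq).isPolyFunOfDegLE hP
    obtain ⟨v, hv⟩ := solve (hc i) ((b i).mulVec u)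
    exact ⟨v, by rw [hL, hv, add_neg_cancel]⟩
  · refine (differencesVanish_of_sum_eq
      (fun i => (L i).comp AddEquiv.prodComm.toAddMonoidHom) (fun i u => ?_) f Q P
      fun x y => ?_).isPolyFunOfDegLE hQ
    · obtain ⟨v, hv⟩ := solve (hb i) ((c i).mulVec u)
      exact ⟨v, show L i (v, u) = 0 by rw [hL, hv, neg_add_cancel]⟩
    · exact (heq y x).trans (add_comm _ _)
end

section
/- Let d, m ≥ 1 be integers and let b_1, …, b_m, c_1, …, c_m be invertible real d×d matrices such that b_i^{-1} c_i − b_j^{-1} c_j is invertible whenever i ≠ j. Let f_1, …, f_m, P : ℝ^d → ℂ be continuous functions satisfying ∑_{i=1}^m f_i(b_i x + c_i y) = P(x) for all x, y ∈ ℝ^d. Then P is a polynomial function of total degree at most m − 1. -/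
/-- Every `M`-fold iterated difference of `F`, with arbitrary increments, vanishes identically. -/
def DiffsVanish {A G : Type*} [AddCommGroup A] [AddCommGroup G] : ℕ → (A → G) → Prop
  | 0, F => F = 0
  | M + 1, F => ∀ h, DiffsVanish M (fwdDiff h F)

theorem fwdDiff_zero_fun {A G : Type*} [AddCommGroup A] [AddCommGroup G] (h : A) :
    fwdDiff h (0 : A → G) = 0 := by
  ext x
  simp [fwdDiff]

theorem DiffsVanish.iterate_sub {A G : Type*} [AddCommGroup A] [AddCommGroup G] {M : ℕ}
    {F : A → G} (hF : DiffsVanish M F) (h : A) (k : ℕ) :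
    DiffsVanish (M - k) ((fwdDiff h)^[k] F) := by
  induction k generalizing M F with
  | zero => exact hF
  | succ k ih =>
    rw [Function.iterate_succ_apply]
    cases M with
    | zero =>
      have hF' : F = 0 := hF
      rw [hF', fwdDiff_zero_fun, Nat.zero_sub]
      simpa using ih (M := 0) (F := (0 : A → G)) rfl
    | succ M =>
      rw [Nat.add_sub_add_right]
      exact ih (hF h)

theorem DiffsVanish.iterate_eq_zero {A G : Type*} [AddCommGroup A] [AddCommGroup G] {M : ℕ}
    {F : A → G} (hF : DiffsVanish M F) (h : A) {k : ℕ} (hk : M ≤ k) :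
    (fwdDiff h)^[k] F = 0 := by
  have := hF.iterate_sub h k
  rwa [Nat.sub_eq_zero_of_le hk] at this

/-- **Newton's formula**, cut off at the order where all differences vanish. -/
theorem DiffsVanish.apply_add_nsmul {A G : Type*} [AddCommGroup A] [AddCommGroup G] {M : ℕ}
    {F : A → G} (hF : DiffsVanish M F) (h y : A) (n : ℕ) :
    F (y + n • h) = ∑ k ∈ Finset.range M, n.choose k • (fwdDiff h)^[k] F y := by
  rw [shift_eq_sum_fwdDiff_iter h F n y]
  trans ∑ k ∈ Finset.range (n + 1 + M), n.choose k • (fwdDiff h)^[k] F y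
  · refine Finset.sum_subset (Finset.range_mono (by omega)) fun k _ hk => ?_
    rw [Nat.choose_eq_zero_of_lt (by simpa using hk), zero_smul]
  · symm
    refine Finset.sum_subset (Finset.range_mono (by omega)) fun k _ hk => ?_
    rw [hF.iterate_eq_zero h (by simpa using hk)]
    simp

/-- The binomial coefficient `((X j - a) / ε).choose k` as a polynomial in several variables. -/
noncomputable def mvChoose {σ : Type*} (j : σ) (a ε : ℂ) (k : ℕ) : MvPolynomial σ ℂ :=
  MvPolynomial.C (k.factorial : ℂ)⁻¹ * ∏ i ∈ Finset.range k,
    (MvPolynomial.C ε⁻¹ * MvPolynomial.X j - MvPolynomial.C (ε⁻¹ * a + i))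

theorem totalDegree_mvChoose_le {σ : Type*} (j : σ) (a ε : ℂ) (k : ℕ) :
    (mvChoose j a ε k).totalDegree ≤ k := by
  refine (MvPolynomial.totalDegree_mul _ _).trans ?_
  rw [MvPolynomial.totalDegree_C, zero_add]
  refine (MvPolynomial.totalDegree_finsetProd _ _).trans ?_
  refine (Finset.sum_le_card_nsmul _ _ 1 fun i _ => ?_).trans (by simp)
  refine (MvPolynomial.totalDegree_sub_C_le _ _).trans ?_
  refine (MvPolynomial.totalDegree_mul _ _).trans ?_
  rw [MvPolynomial.totalDegree_C, MvPolynomial.totalDegree_X]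

theorem eval_mvChoose {σ : Type*} (j : σ) (a : ℂ) {ε : ℂ} (hε : ε ≠ 0) (k n : ℕ) (z : σ → ℂ)
    (hz : z j = a + ε * n) : MvPolynomial.eval z (mvChoose j a ε k) = n.choose k := by
  have h1 : ∀ i : ℕ, ε⁻¹ * (a + ε * n) - (ε⁻¹ * a + i) = (n : ℂ) - i := by
    intro i
    field_simp
    ring
  rw [mvChoose]
  simp only [map_mul, MvPolynomial.eval_C, map_prod, map_sub, MvPolynomial.eval_X, hz, h1]
  rw [← descPochhammer_eval_eq_prod_range, descPochhammer_eval_eq_descFactorial,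
    Nat.descFactorial_eq_factorial_mul_choose, Nat.cast_mul, ← mul_assoc,
    inv_mul_cancel₀ (by exact_mod_cast k.factorial_ne_zero), one_mul]

/-- A function whose `M`-fold differences vanish agrees with a polynomial of degree at most
`M - 1` on the part of the grid `x₀ + ε ℕ^d` spanned by the coordinates in `s`. -/
theorem DiffsVanish.exists_eq_on_grid {d : ℕ} (x₀ : Fin d → ℝ) {ε : ℝ} (hε : ε ≠ 0)
    (s : Finset (Fin d)) {M : ℕ} {F : (Fin d → ℝ) → ℂ} (hF : DiffsVanish M F) :
    ∃ p : MvPolynomial (Fin d) ℂ, p.totalDegree ≤ M - 1 ∧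
      ∀ (n : Fin d → ℕ) (z : Fin d → ℂ), (∀ i ∈ s, z i = x₀ i + ε * n i) →
        F (fun i => if i ∈ s then x₀ i + ε * n i else x₀ i) = MvPolynomial.eval z p := by
  classical
  induction s using Finset.induction_on generalizing M F with
  | empty => exact ⟨MvPolynomial.C (F x₀), by simp, fun n z _ => by simp⟩
  | insert j s hj ih =>
    choose p hp hpe using fun k : ℕ => ih (hF.iterate_sub (Pi.single j ε) k)
    refine ⟨∑ k ∈ Finset.range M, mvChoose j (x₀ j) ε k * p k, ?_, fun n z hz => ?_⟩
    · refine MvPolynomial.totalDegree_finsetSum_le fun k hk => ?_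
      have h1 := MvPolynomial.totalDegree_mul (mvChoose j (x₀ j : ℂ) ε k) (p k)
      have h2 := totalDegree_mvChoose_le j (x₀ j : ℂ) ε k
      have h3 := hp k
      rw [Finset.mem_range] at hk
      omega
    · have hpt : (fun i => if i ∈ insert j s then x₀ i + ε * n i else x₀ i) =
          (fun i => if i ∈ s then x₀ i + ε * n i else x₀ i) + n j • Pi.single j ε := by
        ext i
        by_cases hi : i = j
        · subst hi
          simp [hj, mul_comm]
        · simp [hi]
      rw [hpt, hF.apply_add_nsmul, map_sum]
      refine Finset.sum_congr rfl fun k _ => ?_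
      rw [map_mul, eval_mvChoose j _ (by exact_mod_cast hε) k (n j) z
        (hz j (Finset.mem_insert_self j s)),
        ← hpe k n z fun i hi => hz i (Finset.mem_insert_of_mem hi), nsmul_eq_mul]

/-- **Fréchet's theorem**: a continuous function on `ℝ^d` whose `M`-fold differences vanish is a
polynomial function of degree at most `M - 1`. -/
theorem DiffsVanish.isPolyFunOfDegLE {d M : ℕ} {F : (Fin d → ℝ) → ℂ} (hF : DiffsVanish M F)
    (hFc : Continuous F) : IsPolyFunOfDegLE F (M - 1) := by
  have key : ∀ N : ℕ, ∃ p : MvPolynomial (Fin d) ℂ, p.totalDegree ≤ M - 1 ∧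
      ∀ n : Fin d → ℕ, F (fun i => -(N + 1 : ℝ) + (N + 1 : ℝ)⁻¹ * n i) =
        MvPolynomial.eval (fun i => ((-(N + 1 : ℝ) + (N + 1 : ℝ)⁻¹ * n i : ℝ) : ℂ)) p := by
    intro N
    obtain ⟨p, hp, h⟩ := hF.exists_eq_on_grid (fun _ => -(N + 1 : ℝ))
      (ε := (N + 1 : ℝ)⁻¹) (by positivity) Finset.univ
    refine ⟨p, hp, fun n => ?_⟩
    simpa using h n (fun i => ((-(N + 1 : ℝ) + (N + 1 : ℝ)⁻¹ * n i : ℝ) : ℂ)) (by simp)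
  choose p hp hpe using key
  -- The coarsest grid lies in all the others, so the interpolating polynomials coincide.
  have hpeq : ∀ N, p N = p 0 := by
    intro N
    refine MvPolynomial.funext_set (fun _ => Set.range fun n : ℕ => ((-1 + n : ℝ) : ℂ))
      (fun _ => Set.infinite_range_of_injective fun a b hab => ?_) fun z hz => ?_
    · simpa using hab
    · have hz' : ∀ i, ∃ n : ℕ, ((-1 + n : ℝ) : ℂ) = z i := fun i => hz i (Set.mem_univ i)
      choose n hn using hz'
      have h0 := hpe 0 n
      have hN := hpe N fun i => N * (N + 1) + n i * (N + 1)
      have e : ∀ i, -(N + 1 : ℝ) + (N + 1 : ℝ)⁻¹ * ((N * (N + 1) + n i * (N + 1) : ℕ) : ℝ)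
          = -1 + n i := by
        intro i
        have : (N + 1 : ℝ) ≠ 0 := by positivity
        push_cast
        field_simp
        ring
      have e0 : ∀ i, -(((0 : ℕ) : ℝ) + 1) + (((0 : ℕ) : ℝ) + 1)⁻¹ * (n i : ℝ) = -1 + n i := by
        intro i
        simp
      simp only [e, hn] at hN
      simp only [e0, hn] at h0
      rw [← hN, ← h0]
  refine ⟨p 0, hp 0, fun x => ?_⟩
  let u : ℕ → Fin d → ℝ := fun N i =>
    -(N + 1 : ℝ) + (N + 1 : ℝ)⁻¹ * (⌊(x i + (N + 1)) * (N + 1)⌋₊ : ℝ)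
  have hu : Filter.Tendsto u Filter.atTop (nhds x) := by
    refine tendsto_pi_nhds.2 fun i => ?_
    have hlow : Filter.Tendsto (fun N : ℕ => x i - 1 / ((N : ℝ) + 1)) Filter.atTop
        (nhds (x i)) := by
      simpa using tendsto_one_div_add_atTop_nhds_zero_nat.const_sub (x i)
    refine tendsto_of_tendsto_of_tendsto_of_le_of_le' hlow tendsto_const_nhds ?_ ?_
    · refine Filter.Eventually.of_forall fun N => ?_
      have hN : (0 : ℝ) < N + 1 := by positivity
      have h := (Nat.lt_floor_add_one ((x i + (N + 1)) * ((N : ℝ) + 1))).le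
      have h2 := mul_le_mul_of_nonneg_left h (inv_nonneg.2 hN.le)
      have h3 : ((N : ℝ) + 1)⁻¹ * ((x i + (N + 1)) * ((N : ℝ) + 1)) = x i + (N + 1) := by
        field_simp
      rw [h3, mul_add, mul_one] at h2
      simp only [u, one_div]
      linarith
    · filter_upwards [Filter.eventually_ge_atTop ⌈-x i⌉₊] with N hxN
      have hN : (0 : ℝ) < N + 1 := by positivity
      have h0 : -x i ≤ N := Nat.ceil_le.1 hxN
      have h := Nat.floor_le (mul_nonneg (by linarith : 0 ≤ x i + ((N : ℝ) + 1)) hN.le)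
      have h2 := mul_le_mul_of_nonneg_left h (inv_nonneg.2 hN.le)
      have h3 : ((N : ℝ) + 1)⁻¹ * ((x i + (N + 1)) * ((N : ℝ) + 1)) = x i + (N + 1) := by
        field_simp
      rw [h3] at h2
      simp only [u]
      linarith
  have hcont : Continuous fun y : Fin d → ℝ =>
      MvPolynomial.eval (fun j => (y j : ℂ)) (p 0) :=
    (MvPolynomial.continuous_eval (p 0)).comp (by fun_prop)
  refine tendsto_nhds_unique ((hFc.tendsto x).comp hu) (((hcont.tendsto x).comp hu).congr ?_)
  intro N
  have h := hpe N fun i => ⌊(x i + (N + 1)) * (N + 1)⌋₊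
  rw [hpeq N] at h
  exact h.symm

/-- If `P x = ∑ i ∈ s, f i (B i x + C i y)` for all `x` and `y`, with each `C i` surjective, then
the `#s`-fold differences of `P` vanish. -/
theorem diffsVanish_of_sum_eq {ι A E G : Type*} [AddCommGroup A] [AddCommGroup E]
    [AddCommGroup G] (B C : ι → A →+ E) (hC : ∀ i, Function.Surjective (C i)) (s : Finset ι)
    (f : ι → E → G) (P : A → G) (heq : ∀ x y, ∑ i ∈ s, f i (B i x + C i y) = P x) :
    DiffsVanish s.card P := by
  classical
  induction s using Finset.induction_on generalizing f P with
  | empty =>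
    funext x
    simpa using (heq x 0).symm
  | insert j s hj ih =>
    rw [Finset.card_insert_of_notMem hj]
    intro h
    obtain ⟨k, hk⟩ := hC j (-B j h)
    refine ih (fun i => fwdDiff (B i h + C i k) (f i)) _ fun x y => ?_
    have hshift : ∀ i, B i (x + h) + C i (y + k) = B i x + C i y + (B i h + C i k) := by
      intro i
      rw [map_add, map_add]
      abel
    have h1 := heq (x + h) (y + k)
    have h2 := heq x y
    simp only [hshift] at h1
    rw [Finset.sum_insert hj, hk, add_neg_cancel, add_zero] at h1
    rw [Finset.sum_insert hj] at h2
    simp only [fwdDiff]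
    rw [← h1, ← h2, Finset.sum_sub_distrib]
    abel

theorem stmt_5 {d m : ℕ} (hd : 0 < d) (hm : 0 < m)
    (b c : Fin m → Matrix (Fin d) (Fin d) ℝ)
    (hb : ∀ i, IsUnit (b i)) (hc : ∀ i, IsUnit (c i))
    (hij : ∀ i j, i ≠ j → IsUnit ((b i)⁻¹ * c i - (b j)⁻¹ * c j))
    (f : Fin m → (Fin d → ℝ) → ℂ) (hf : ∀ i, Continuous (f i))
    (P : (Fin d → ℝ) → ℂ) (hP : Continuous P)
    (heq : ∀ x y : Fin d → ℝ,
      ∑ i, f i ((b i).mulVec x + (c i).mulVec y) = P x) :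
    IsPolyFunOfDegLE P (m - 1) := by
  have h := diffsVanish_of_sum_eq (fun i => (b i).mulVecLin.toAddMonoidHom)
    (fun i => (c i).mulVecLin.toAddMonoidHom)
    (fun i => Matrix.mulVec_surjective_iff_isUnit.2 (hc i)) Finset.univ f P heq
  rw [Finset.card_univ, Fintype.card_fin] at h
  exact h.isPolyFunOfDegLE hP
end

section
/- Let d, m ≥ 1 be integers and let f : ℝ^d → ℂ be a continuous function such that f(x) + ∑_{i=1}^m binom(m,i) (−1)^{m−i} f(x + i·y) = 0 for all x, y ∈ ℝ^d (where i·y denotes the scalar multiple of y by the integer i). Then f is a polynomial function of total degree at most m − 1. -/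
/-- Along an arithmetic progression, a function killed by the `m`-th forward difference is given by
Newton's interpolation polynomial. -/
theorem exists_polynomial_eval_natCast_of_fwdDiff_iter_eq_zero {m : ℕ} (hm : 0 < m) {g : ℝ → ℂ}
    {h : ℝ} (hg : (fwdDiff h)^[m] g = 0) (y : ℝ) :
    ∃ P : Polynomial ℂ, P.natDegree < m ∧ ∀ n : ℕ, g (y + n * h) = P.eval (n : ℂ) := by
  have hvanish : ∀ k, m ≤ k → (fwdDiff h)^[k] g y = 0 := by
    intro k hk
    obtain ⟨j, rfl⟩ := Nat.exists_eq_add_of_le' hk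
    rw [Function.iterate_add_apply, hg, ← fwdDiff_aux.coe_fwdDiffₗ_pow, map_zero, Pi.zero_apply]
  refine ⟨∑ k ∈ Finset.range m,
    Polynomial.C ((fwdDiff h)^[k] g y / (k.factorial : ℂ)) * descPochhammer ℂ k, ?_, fun n => ?_⟩
  · have hle : ∀ k ∈ Finset.range m, (Polynomial.C ((fwdDiff h)^[k] g y / (k.factorial : ℂ)) *
        descPochhammer ℂ k).natDegree ≤ m - 1 := fun k hk =>
      (Polynomial.natDegree_C_mul_le _ _).trans
        (by rw [descPochhammer_natDegree]; have := Finset.mem_range.1 hk; omega)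
    have := Polynomial.natDegree_sum_le_of_forall_le _ _ hle
    omega
  · have hterm : ∀ k, ((fwdDiff h)^[k] g y / (k.factorial : ℂ)) * (descPochhammer ℂ k).eval (n : ℂ) =
        n.choose k • (fwdDiff h)^[k] g y := by
      intro k
      have : (k.factorial : ℂ) ≠ 0 := by exact_mod_cast k.factorial_ne_zero
      rw [descPochhammer_eval_eq_descFactorial, Nat.descFactorial_eq_factorial_mul_choose,
        nsmul_eq_mul]
      push_cast
      field_simp
    rw [← nsmul_eq_mul (n : ℕ) h, shift_eq_sum_fwdDiff_iter h g n y, Polynomial.eval_finsetSum]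
    simp only [Polynomial.eval_mul, Polynomial.eval_C, hterm]
    trans ∑ k ∈ Finset.range (n + 1 + m), n.choose k • (fwdDiff h)^[k] g y
    · refine Finset.sum_subset (Finset.range_mono (by omega)) fun k _ hk => ?_
      rw [Nat.choose_eq_zero_of_lt (by simpa using hk), zero_smul]
    · refine (Finset.sum_subset (Finset.range_mono (by omega)) fun k _ hk => ?_).symm
      rw [hvanish k (by simpa using hk), smul_zero]

/-- **Fréchet's theorem** on the real line. -/
theorem exists_polynomial_of_continuous_of_fwdDiff_iter_eq_zero {m : ℕ} (hm : 0 < m) {g : ℝ → ℂ}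
    (hcont : Continuous g) (hg : ∀ h, (fwdDiff h)^[m] g = 0) :
    ∃ P : Polynomial ℂ, P.natDegree < m ∧ ∀ t : ℝ, g t = P.eval (t : ℂ) := by
  obtain ⟨P, hdeg, hP⟩ := exists_polynomial_eval_natCast_of_fwdDiff_iter_eq_zero hm (hg 1) 0
  refine ⟨P, hdeg, fun t => congrFun (Rat.denseRange_cast.equalizer hcont
    (P.continuous.comp Complex.continuous_ofReal) (funext fun q => ?_)) t⟩
  obtain ⟨Q, -, hQ⟩ := exists_polynomial_eval_natCast_of_fwdDiff_iter_eq_zero hm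
    (hg (1 / (q.den : ℝ))) (-(q.num.natAbs : ℝ))
  have hPQ : P = Q.comp (Polynomial.C ((q.num.natAbs : ℂ) * q.den) +
      Polynomial.X * Polynomial.C (q.den : ℂ)) := by
    refine Polynomial.eq_of_infinite_eval_eq _ _
      ((Set.infinite_range_of_injective (Nat.cast_injective (R := ℂ))).mono ?_)
    rintro _ ⟨j, rfl⟩
    have h1 := hP j
    have h2 := hQ (q.num.natAbs * q.den + j * q.den)
    have h3 : -(q.num.natAbs : ℝ) + ((q.num.natAbs * q.den + j * q.den : ℕ) : ℝ) *
        (1 / (q.den : ℝ)) = 0 + (j : ℝ) * 1 := by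
      push_cast
      field_simp
      ring
    rw [h3, h1] at h2
    simpa using h2
  obtain ⟨n, hn⟩ : ∃ n : ℕ, (n : ℤ) = q.num.natAbs * q.den + q.num := by
    refine ⟨(q.num.natAbs * q.den + q.num : ℤ).toNat, Int.toNat_of_nonneg ?_⟩
    have h1 : (1 : ℤ) ≤ q.den := by exact_mod_cast q.den_pos
    have h2 : -q.num ≤ (q.num.natAbs : ℤ) := by omega
    nlinarith [Int.natCast_nonneg q.num.natAbs]
  have hq : (q : ℝ) * q.den = q.num := by exact_mod_cast Rat.mul_den_eq_num q
  have hqc : (q : ℂ) * q.den = q.num := by exact_mod_cast Rat.mul_den_eq_num q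
  have hnr : (n : ℝ) = q.num.natAbs * q.den + q.num := by
    simpa using congrArg (Int.cast : ℤ → ℝ) hn
  have hnc : (n : ℂ) = q.num.natAbs * q.den + q.num := by
    simpa using congrArg (Int.cast : ℤ → ℂ) hn
  have harg : -(q.num.natAbs : ℝ) + n * (1 / (q.den : ℝ)) = q := by
    rw [hnr, ← hq]
    field_simp
    ring
  have := hQ n
  rw [harg, hnc, ← hqc] at this
  simp only [Function.comp_apply, Complex.ofReal_ratCast]
  rw [this, hPQ]
  simp

/-- A function that is polynomial of bounded degree in each variable is polynomial. -/
theorem exists_mvPolynomial_of_forall_update {m : ℕ} : ∀ {d : ℕ} {f : (Fin d → ℝ) → ℂ},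
    (∀ x i, ∃ P : Polynomial ℂ, P.natDegree < m ∧
      ∀ t : ℝ, f (Function.update x i t) = P.eval (t : ℂ)) →
    ∃ p : MvPolynomial (Fin d) ℂ, ∀ x, f x = MvPolynomial.eval (fun j => (x j : ℂ)) p := by
  intro d
  induction d with
  | zero =>
    intro f _
    exact ⟨MvPolynomial.C (f 0), fun x => by simp [Subsingleton.elim x 0]⟩
  | succ d ih =>
    intro f hf
    have hslice : ∀ a : ℝ, ∃ p : MvPolynomial (Fin d) ℂ, ∀ x : Fin d → ℝ,
        f (Fin.cons a x) = MvPolynomial.eval (fun j => (x j : ℂ)) p := by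
      refine fun a => ih fun x i => ?_
      obtain ⟨P, hdeg, hP⟩ := hf (Fin.cons a x) i.succ
      exact ⟨P, hdeg, fun t => by rw [← hP t, Fin.cons_update]⟩
    choose p hp using hslice
    have hinj : Set.InjOn (fun k : ℕ => (k : ℂ)) (Finset.range m) := Nat.cast_injective.injOn
    refine ⟨∑ k ∈ Finset.range m, MvPolynomial.rename Fin.succ (p k) *
      Polynomial.aeval (MvPolynomial.X 0)
        (Lagrange.basis (Finset.range m) (fun k : ℕ => (k : ℂ)) k), fun x => ?_⟩
    obtain ⟨P, hdeg, hP⟩ := hf x 0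
    have hupd : ∀ t : ℝ, Function.update x 0 t = Fin.cons t (Fin.tail x) := fun t => by
      rw [← Fin.cons_self_tail x, Fin.update_cons_zero, Fin.tail_cons]
    have hPL := Lagrange.eq_interpolate_of_eval_eq (f := P)
      (fun k : ℕ => f (Fin.cons (k : ℝ) (Fin.tail x))) hinj
      (by
        rw [Finset.card_range]
        exact Polynomial.degree_le_natDegree.trans_lt (by exact_mod_cast hdeg))
      (fun k _ => by rw [← hupd, hP]; simp)
    have hx := hP (x 0)
    rw [Function.update_eq_self, hPL, Lagrange.interpolate_apply, Polynomial.eval_finsetSum] at hx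
    rw [hx, map_sum]
    refine Finset.sum_congr rfl fun k _ => ?_
    rw [Polynomial.eval_mul, Polynomial.eval_C, map_mul, MvPolynomial.eval_rename, hp]
    congr 1
    rw [← MvPolynomial.coe_aeval_eq_eval, RingHom.coe_coe, ← Polynomial.aeval_algHom_apply]
    simp [Polynomial.aeval_def]

/-- A homogeneous polynomial of degree `k` scales by `t ^ k`. -/
theorem MvPolynomial.IsHomogeneous.eval_mul {σ R : Type*} [Fintype σ] [CommSemiring R]
    {q : MvPolynomial σ R} {k : ℕ} (hq : q.IsHomogeneous k) (t : R) (x : σ → R) :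
    MvPolynomial.eval (fun j => t * x j) q = t ^ k * MvPolynomial.eval x q := by
  rw [MvPolynomial.eval_eq', MvPolynomial.eval_eq', Finset.mul_sum]
  refine Finset.sum_congr rfl fun e he => ?_
  have hdeg : ∑ i, e i = k := by
    rw [← hq (MvPolynomial.mem_support_iff.1 he), Finsupp.weight_apply, Finsupp.sum_fintype] <;> simp
  simp only [mul_pow, Finset.prod_mul_distrib, Finset.prod_pow_eq_pow_sum, hdeg]
  ring

/-- A multivariate polynomial whose restriction to each real line through the origin has degree less
than `m` has total degree at most `m - 1`. -/
theorem MvPolynomial.totalDegree_le_of_forall_line {d m : ℕ} (p : MvPolynomial (Fin d) ℂ)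
    (hp : ∀ x : Fin d → ℝ, ∃ P : Polynomial ℂ, P.natDegree < m ∧
      ∀ t : ℝ, MvPolynomial.eval (fun j => ((t * x j : ℝ) : ℂ)) p = P.eval (t : ℂ)) :
    p.totalDegree ≤ m - 1 := by
  have hzero : ∀ i, m ≤ i → i ≤ p.totalDegree → homogeneousComponent i p = 0 := by
    intro i hi hip
    refine MvPolynomial.funext_set (fun _ => Set.range ((↑) : ℝ → ℂ))
      (fun _ => Set.infinite_range_of_injective Complex.ofReal_injective) fun z hz => ?_
    choose x hx using fun j => hz j trivial
    obtain rfl : (fun j => (x j : ℂ)) = z := _root_.funext hx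
    obtain ⟨P, hdeg, hP⟩ := hp x
    have hPeq : P = ∑ k ∈ Finset.range (p.totalDegree + 1), Polynomial.monomial k
        (eval (fun j => (x j : ℂ)) (homogeneousComponent k p)) := by
      refine Polynomial.eq_of_infinite_eval_eq _ _
        ((Set.infinite_range_of_injective Complex.ofReal_injective).mono ?_)
      rintro _ ⟨t, rfl⟩
      rw [Set.mem_ofPred_eq, ← hP, Polynomial.eval_finsetSum]
      conv_lhs => rw [← sum_homogeneousComponent p, map_sum]
      refine Finset.sum_congr rfl fun k _ => ?_
      simp only [Complex.ofReal_mul, Polynomial.eval_monomial,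
        (homogeneousComponent_isHomogeneous k p).eval_mul]
      rw [mul_comm]
    have hcoeff := Polynomial.coeff_eq_zero_of_natDegree_lt (hdeg.trans_le hi)
    rw [hPeq, Polynomial.finsetSum_coeff] at hcoeff
    simpa [Polynomial.coeff_monomial, Nat.lt_succ_iff.2 hip, hip] using hcoeff
  rw [← sum_homogeneousComponent p]
  refine totalDegree_finsetSum_le fun i hi => ?_
  by_cases him : m ≤ i
  · rw [hzero i him (Nat.lt_succ_iff.1 (Finset.mem_range.1 hi)), totalDegree_zero]
    exact Nat.zero_le _
  · exact (homogeneousComponent_isHomogeneous i p).totalDegree_le.trans (by omega)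

/-- **Fréchet's theorem** on `ℝ^d`. -/
theorem isPolyFunOfDegLE_of_fwdDiff_iter_eq_zero {d m : ℕ} (hm : 0 < m) {f : (Fin d → ℝ) → ℂ}
    (hf : Continuous f) (h : ∀ y, (fwdDiff y)^[m] f = 0) : IsPolyFunOfDegLE f (m - 1) := by
  have hline : ∀ x y : Fin d → ℝ, ∃ P : Polynomial ℂ, P.natDegree < m ∧
      ∀ t : ℝ, f (x + t • y) = P.eval (t : ℂ) := by
    intro x y
    refine exists_polynomial_of_continuous_of_fwdDiff_iter_eq_zero
      (g := fun t : ℝ => f (x + t • y)) hm (by fun_prop) fun s => funext fun t => ?_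
    have := congrFun (h (s • y)) (x + t • y)
    rw [fwdDiff_iter_eq_sum_shift] at this ⊢
    rw [Pi.zero_apply] at this ⊢
    rw [← this]
    refine Finset.sum_congr rfl fun k _ => ?_
    rw [add_smul, smul_assoc, add_assoc]
  obtain ⟨p, hp⟩ := exists_mvPolynomial_of_forall_update (m := m) (f := f) fun x i => by
    obtain ⟨P, hdeg, hP⟩ := hline (Function.update x i 0) (Pi.single i 1)
    refine ⟨P, hdeg, fun t => ?_⟩
    rw [← hP]
    congr 1
    ext j
    by_cases hj : j = i
    · subst hj; simp
    · simp [hj]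
  refine ⟨p, p.totalDegree_le_of_forall_line fun x => ?_, hp⟩
  obtain ⟨P, hdeg, hP⟩ := hline 0 x
  exact ⟨P, hdeg, fun t => by rw [← hP, zero_add, hp]; simp⟩

theorem stmt_7 {d m : ℕ} (hd : 0 < d) (hm : 0 < m)
    (f : (Fin d → ℝ) → ℂ) (hf : Continuous f)
    (heq : ∀ x y : Fin d → ℝ,
      f x + ∑ i ∈ Finset.Icc 1 m,
        (m.choose i : ℂ) * (-1 : ℂ) ^ (m - i) * f (x + (i : ℝ) • y) = 0) :
    IsPolyFunOfDegLE f (m - 1) := by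
  have hsum : ∀ x y : Fin d → ℝ, (fwdDiff y)^[m] f x = (-1 : ℂ) ^ m * f x +
      ∑ i ∈ Finset.Icc 1 m, (m.choose i : ℂ) * (-1 : ℂ) ^ (m - i) * f (x + (i : ℝ) • y) := by
    intro x y
    rw [fwdDiff_iter_eq_sum_shift, Finset.sum_range_eq_add_Ico _ (by omega)]
    congr 1
    · simp
    · refine Finset.sum_congr (by ext; simp [Nat.one_le_iff_ne_zero]) fun i _ => ?_
      rw [Nat.cast_smul_eq_nsmul, zsmul_eq_mul]
      push_cast
      ring
  rcases Nat.even_or_odd m with hm2 | hm2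
  · refine isPolyFunOfDegLE_of_fwdDiff_iter_eq_zero hm hf fun y => funext fun x => ?_
    rw [hsum, hm2.neg_one_pow, one_mul, heq, Pi.zero_apply]
  · -- For odd `m` the coefficient of `f x` is `1` rather than `(-1) ^ m`, which forces `f = 0`.
    refine ⟨0, by simp, fun x => ?_⟩
    have h0 : (fwdDiff (0 : Fin d → ℝ))^[m] f x = 0 := by
      obtain ⟨k, rfl⟩ := Nat.exists_eq_add_of_lt hm
      have hz : fwdDiff (0 : Fin d → ℝ) f = 0 := by ext; simp [fwdDiff]
      rw [Function.iterate_succ_apply, hz, ← fwdDiff_aux.coe_fwdDiffₗ_pow, map_zero, Pi.zero_apply]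
    have h1 := hsum x 0
    have h2 := heq x 0
    rw [h0, hm2.neg_one_pow] at h1
    rw [map_zero]
    linear_combination (h1 + h2) / 2
end

section
/- Let d ≥ 2 and n ≥ 1 be integers, let δ > 0, and let a_0, a_1, …, a_n ∈ ℂ with a_n ≠ 0. Let f : ℝ^d → ℂ be a continuous function such that ∑_{k=0}^n a_k f(x + k·y) = 0 for all x ∈ ℝ^d and all y ∈ ℝ^d with ‖y‖ = δ (Euclidean norm), where k·y denotes the scalar multiple of y by the integer k. Then f is a polynomial function. -/
/-- `f : ℝ^d → ℂ` (with `ℝ^d` carrying the Euclidean norm) is a polynomial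
function: it agrees with the evaluation of a multivariate polynomial. -/
def IsPolyFunE {d : ℕ} (f : EuclideanSpace ℝ (Fin d) → ℂ) : Prop :=
  ∃ p : MvPolynomial (Fin d) ℂ,
    ∀ x : EuclideanSpace ℝ (Fin d), f x = MvPolynomial.eval (fun j => (x j : ℂ)) p

open Polynomial in
/-- A single monic polynomial annihilates every product of two roots of `p` modulo an ideal. -/
theorem exists_monic_aeval_mul_mem (p : ℂ[X]) (hp : p ≠ 0) :
    ∃ q : ℂ[X], q.Monic ∧ ∀ (A : Type) [CommRing A] [Algebra ℂ A] (I : Ideal A) (x y : A),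
      aeval x p ∈ I → aeval y p ∈ I → aeval (x * y) q ∈ I := by
  have hroot : IsIntegral ℂ (AdjoinRoot.root p) := (AdjoinRoot.isAlgebraic_root hp).isIntegral
  have hl : IsIntegral ℂ (AdjoinRoot.root p ⊗ₜ[ℂ] (1 : AdjoinRoot p)) :=
    hroot.map (Algebra.TensorProduct.includeLeft : AdjoinRoot p →ₐ[ℂ] _)
  have hr : IsIntegral ℂ ((1 : AdjoinRoot p) ⊗ₜ[ℂ] AdjoinRoot.root p) :=
    hroot.map (Algebra.TensorProduct.includeRight : AdjoinRoot p →ₐ[ℂ] _)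
  obtain ⟨q, hq, hq0⟩ := hl.mul hr
  refine ⟨q, hq, fun A _ _ I x y hx hy => ?_⟩
  have lift_root : ∀ z : A, aeval z p ∈ I → ∃ φ : AdjoinRoot p →ₐ[ℂ] A ⧸ I,
      φ (AdjoinRoot.root p) = Ideal.Quotient.mkₐ ℂ I z := by
    intro z hz
    have h0 : aeval (Ideal.Quotient.mkₐ ℂ I z) p = 0 := by
      rw [aeval_algHom_apply]
      exact Ideal.Quotient.eq_zero_iff_mem.2 hz
    exact ⟨AdjoinRoot.liftAlgHom p (Algebra.ofId ℂ _) _ h0, by simp⟩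
  obtain ⟨φ, hφ⟩ := lift_root x hx
  obtain ⟨ψ, hψ⟩ := lift_root y hy
  have h := congrArg (Algebra.TensorProduct.lift φ ψ fun _ _ => Commute.all _ _) hq0
  rw [← aeval_def, ← aeval_algHom_apply, map_mul, Algebra.TensorProduct.lift_tmul,
    Algebra.TensorProduct.lift_tmul, hφ, hψ, map_one, map_one, mul_one, one_mul, map_zero,
    ← map_mul, aeval_algHom_apply] at h
  exact Ideal.Quotient.eq_zero_iff_mem.1 h

section GroupAlgebra

variable {E : Type} [AddCommGroup E]

/-- The group algebra `ℂ[E]` acts on functions on `E` by translations. -/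
noncomputable def translationAction (E : Type) [AddCommGroup E] :
    AddMonoidAlgebra ℂ E →ₐ[ℂ] Module.End ℂ (E → ℂ) :=
  AddMonoidAlgebra.lift ℂ _ E
    { toFun := fun h => LinearMap.funLeft ℂ ℂ fun x => x + h.toAdd
      map_one' := by ext; simp [LinearMap.funLeft]
      map_mul' := fun g h => by
        ext F x
        simp [LinearMap.funLeft_apply, add_assoc] }

theorem translationAction_single (h : E) (c : ℂ) (f : E → ℂ) (x : E) :
    translationAction E (AddMonoidAlgebra.single h c) f x = c * f (x + h) := by
  simp [translationAction, LinearMap.funLeft_apply]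

/-- The elements of the group algebra that annihilate `f`. -/
noncomputable def translationAnnihilator (f : E → ℂ) : Ideal (AddMonoidAlgebra ℂ E) where
  carrier := {A | translationAction E A f = 0}
  add_mem' := fun {A B} hA hB => by
    have hA : translationAction E A f = 0 := hA
    have hB : translationAction E B f = 0 := hB
    simp [hA, hB]
  zero_mem' := by simp
  smul_mem' := fun A B hB => by
    have hB : translationAction E B f = 0 := hB
    simp [hB]

theorem mem_translationAnnihilator {f : E → ℂ} {A : AddMonoidAlgebra ℂ E} :
    A ∈ translationAnnihilator f ↔ translationAction E A f = 0 := Iff.rfl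

/-- The group element `h`, viewed in the group algebra. -/
noncomputable abbrev groupElem (h : E) : AddMonoidAlgebra ℂ E := AddMonoidAlgebra.single h 1

theorem groupElem_add (g h : E) : groupElem (g + h) = groupElem g * groupElem h := by
  simp [groupElem, AddMonoidAlgebra.single_mul_single]

theorem groupElem_zero : groupElem (0 : E) = 1 := rfl

theorem groupElem_nsmul (k : ℕ) (h : E) : groupElem (k • h) = groupElem h ^ k := by
  simp [groupElem, AddMonoidAlgebra.single_pow]

theorem translationAction_groupElem_sub_one (h : E) (f : E → ℂ) :
    translationAction E (groupElem h - 1) f = fwdDiff h f := by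
  ext x
  simp [translationAction_single, fwdDiff]

end GroupAlgebra

section Norm

variable {E : Type} [NormedAddCommGroup E] [NormedSpace ℝ E]

/-- Eliminating one by one the terms of index `j < m` from a relation
`∑ b_j τ_h^j` which holds for all `h` in a neighbourhood of zero. -/
theorem sum_mul_prod_groupElem_sub_one_mem (I : Ideal (AddMonoidAlgebra ℂ E)) (N : ℕ) (b : ℕ → ℂ) (r : ℝ)
    (hI : ∀ h : E, ‖h‖ ≤ r → ∑ j ∈ Finset.range (N + 1),
      b j • groupElem ((j : ℝ) • h) ∈ I) (m : ℕ) (h : E) (t : ℕ → E)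
    (ht : ‖h‖ + ∑ k ∈ Finset.range m, ‖t k‖ ≤ r) :
    ∑ j ∈ Finset.range (N + 1), b j • (groupElem ((j : ℝ) • h) *
      ∏ k ∈ Finset.range m, (groupElem (((j : ℝ) - k) • t k) - 1)) ∈ I := by
  induction m generalizing h with
  | zero => simpa using hI h (by simpa using ht)
  | succ m ih =>
    rw [Finset.sum_range_succ] at ht
    have h1 := ih (h + t m) (by linarith [norm_add_le h (t m)])
    have h2 := ih h (by linarith [norm_nonneg (t m)])
    convert I.sub_mem (I.mul_mem_left (groupElem (-(m : ℝ) • t m)) h1) h2 using 1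
    rw [Finset.mul_sum, ← Finset.sum_sub_distrib]
    refine Finset.sum_congr rfl fun j _ => ?_
    have e : groupElem ((j : ℝ) • (h + t m)) * groupElem (-(m : ℝ) • t m)
        = groupElem ((j : ℝ) • h) * groupElem (((j : ℝ) - m) • t m) := by
      rw [← groupElem_add, ← groupElem_add]
      congr 1
      module
    rw [Finset.prod_range_succ, mul_smul_comm, ← smul_sub]
    congr 1
    linear_combination -(∏ k ∈ Finset.range m, (groupElem (((j : ℝ) - k) • t k) - 1)) * e

theorem prod_groupElem_sub_one_mem (I : Ideal (AddMonoidAlgebra ℂ E)) (q : Polynomial ℂ)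
    (hq : q.Monic) (r : ℝ) (hr : 0 < r)
    (hI : ∀ h : E, ‖h‖ ≤ r → Polynomial.aeval (groupElem h) q ∈ I) (s : ℕ → E) :
    ∏ k ∈ Finset.range q.natDegree, (groupElem (s k) - 1) ∈ I := by
  set N := q.natDegree with hN
  obtain ⟨M, hM⟩ := exists_nat_gt ((∑ k ∈ Finset.range N, ‖s k‖) / r)
  have hS : 0 ≤ ∑ k ∈ Finset.range N, ‖s k‖ := Finset.sum_nonneg fun _ _ => norm_nonneg _
  have hM0 : (0 : ℝ) < M := lt_of_le_of_lt (by positivity) hM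
  have hsmall : ∏ k ∈ Finset.range N, (groupElem ((M : ℝ)⁻¹ • s k) - 1) ∈ I := by
    have key := sum_mul_prod_groupElem_sub_one_mem I N q.coeff r
      (fun h hh => by
        have := hI h hh
        rw [Polynomial.aeval_eq_sum_range] at this
        simpa only [← groupElem_nsmul, ← Nat.cast_smul_eq_nsmul ℝ] using this)
      N 0 (fun k => ((N : ℝ) - k)⁻¹ • (M : ℝ)⁻¹ • s k) (by
        rw [norm_zero, zero_add]
        have : ∑ k ∈ Finset.range N, ‖((N : ℝ) - k)⁻¹ • (M : ℝ)⁻¹ • s k‖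
            ≤ ∑ k ∈ Finset.range N, (M : ℝ)⁻¹ * ‖s k‖ := by
          refine Finset.sum_le_sum fun k hk => ?_
          have hk' : (1 : ℝ) ≤ (N : ℝ) - k := by
            have : k + 1 ≤ N := Finset.mem_range.1 hk
            have : (k : ℝ) + 1 ≤ N := by exact_mod_cast this
            linarith
          rw [norm_smul, norm_smul, norm_inv, norm_inv, Real.norm_of_nonneg (by linarith),
            Real.norm_of_nonneg hM0.le]
          exact mul_le_of_le_one_left (by positivity) (inv_le_one_of_one_le₀ hk')
        refine this.trans ?_
        rw [← Finset.mul_sum, inv_mul_le_iff₀ hM0]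
        exact ((div_lt_iff₀ hr).1 hM).le)
    rw [Finset.sum_range_succ, Finset.sum_eq_zero] at key
    · rw [zero_add, hN, hq.coeff_natDegree, ← hN, one_smul, smul_zero, groupElem_zero,
        one_mul] at key
      convert key using 1
      refine Finset.prod_congr rfl fun k hk => ?_
      have hk' : (N : ℝ) - k ≠ 0 :=
        sub_ne_zero.2 (by exact_mod_cast (Finset.mem_range.1 hk).ne')
      rw [smul_inv_smul₀ hk']
    · intro j hj
      rw [Finset.prod_eq_zero hj (by rw [sub_self, zero_smul, groupElem_zero, sub_self]),
        mul_zero, smul_zero]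
  refine I.mem_of_dvd (Finset.prod_dvd_prod_of_dvd _ _ fun k _ => ?_) hsmall
  have : groupElem (s k) = groupElem ((M : ℝ)⁻¹ • s k) ^ M := by
    rw [← groupElem_nsmul, ← Nat.cast_smul_eq_nsmul ℝ, smul_inv_smul₀ hM0.ne']
  rw [this]
  exact sub_one_dvd_pow_sub_one _ _

end Norm

open Polynomial in
/-- Newton's interpolation formula on an arithmetic progression. -/
theorem exists_polynomial_eq_on_progression (g : ℝ → ℂ) (N : ℕ) (s : ℝ) (hs : s ≠ 0)
    (hg : (fwdDiff s)^[N] g = 0) (x : ℝ) :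
    ∃ P : ℂ[X], P.degree < N ∧ ∀ n : ℕ, g (x + n * s) = P.eval ((x + n * s : ℝ) : ℂ) := by
  refine ⟨∑ k ∈ Finset.range N, C ((fwdDiff s)^[k] g x / (k.factorial : ℂ)) *
    (descPochhammer ℂ k).comp (C (s : ℂ)⁻¹ * (X - C (x : ℂ))), ?_, fun n => ?_⟩
  · refine mem_degreeLT.1 (Submodule.sum_mem _ fun k hk => mem_degreeLT.2 ?_)
    refine lt_of_le_of_lt degree_le_natDegree ?_
    refine lt_of_le_of_lt ?_ (Nat.cast_lt.2 (Finset.mem_range.1 hk))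
    refine Nat.cast_le.2 ((natDegree_C_mul_le _ _).trans (natDegree_comp_le.trans ?_))
    rw [descPochhammer_natDegree]
    exact mul_le_of_le_one_right (Nat.zero_le _)
      ((natDegree_C_mul_le _ _).trans (natDegree_X_sub_C_le _))
  · have hzero : ∀ k, N ≤ k → (fwdDiff s)^[k] g x = 0 := fun k hk => by
      obtain ⟨m, rfl⟩ := Nat.exists_eq_add_of_le' hk
      rw [Function.iterate_add_apply, hg, ← fwdDiff_aux.coe_fwdDiffₗ_pow, map_zero]
      rfl
    have hs' : (s : ℂ) ≠ 0 := by exact_mod_cast hs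
    rw [← nsmul_eq_mul, shift_eq_sum_fwdDiff_iter s g n x, eval_finsetSum]
    have h1 : ∑ k ∈ Finset.range (n + 1), n.choose k • (fwdDiff s)^[k] g x
        = ∑ k ∈ Finset.range (n + 1 + N), n.choose k • (fwdDiff s)^[k] g x := by
      refine Finset.sum_subset (Finset.range_mono (by omega)) fun k _ hk => ?_
      rw [Nat.choose_eq_zero_of_lt (by simpa using hk), zero_smul]
    have h2 : ∑ k ∈ Finset.range N, n.choose k • (fwdDiff s)^[k] g x
        = ∑ k ∈ Finset.range (n + 1 + N), n.choose k • (fwdDiff s)^[k] g x := by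
      refine Finset.sum_subset (Finset.range_mono (by omega)) fun k _ hk => ?_
      rw [hzero k (by simpa using hk), smul_zero]
    rw [h1, ← h2]
    refine Finset.sum_congr rfl fun k _ => ?_
    have harg : (s : ℂ)⁻¹ * (((x + n • s : ℝ) : ℂ) - x) = n := by
      push_cast [nsmul_eq_mul]
      field_simp
      ring
    rw [eval_mul, eval_C, eval_comp, eval_mul, eval_sub, eval_C, eval_C, eval_X, harg,
      descPochhammer_eval_eq_descFactorial, Nat.descFactorial_eq_factorial_mul_choose,
      nsmul_eq_mul]
    have : (k.factorial : ℂ) ≠ 0 := by exact_mod_cast k.factorial_ne_zero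
    push_cast
    field_simp

open Polynomial in
/-- A continuous function of one real variable all of whose `N`-th differences vanish is equal to
its Lagrange interpolant at `0, …, N - 1`. -/
theorem eq_interpolate_of_fwdDiff_iter_eq_zero (g : ℝ → ℂ) (hc : Continuous g) (N : ℕ)
    (hg : ∀ s, (fwdDiff s)^[N] g = 0) (t : ℝ) :
    g t = ∑ i ∈ Finset.range N,
      g i * (Lagrange.basis (Finset.range N) (fun j : ℕ => (j : ℂ)) i).eval (t : ℂ) := by
  have hinj : Set.InjOn (fun j : ℕ => (j : ℂ)) (Finset.range N) := Nat.cast_injective.injOn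
  have hcont : Continuous fun t : ℝ => ∑ i ∈ Finset.range N,
      g i * (Lagrange.basis (Finset.range N) (fun j : ℕ => (j : ℂ)) i).eval (t : ℂ) := by
    fun_prop
  refine congrFun (Rat.denseRange_cast.equalizer hc hcont (funext fun q => ?_)) t
  set M := q.num.natAbs
  have hden : (q.den : ℝ) ≠ 0 := by exact_mod_cast q.den_nz
  obtain ⟨P, hP, hPg⟩ := exists_polynomial_eq_on_progression g N (q.den : ℝ)⁻¹
    (inv_ne_zero hden) (hg _) (-M)
  have hnode : ∀ i : ℕ, g i = P.eval (i : ℂ) := fun i => by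
    have e : -(M : ℝ) + ((i + M) * q.den : ℕ) * (q.den : ℝ)⁻¹ = i := by
      push_cast
      field_simp
      ring
    have := hPg ((i + M) * q.den)
    rw [e] at this
    simpa using this
  have hq : g q = P.eval ((q : ℝ) : ℂ) := by
    have hnn : 0 ≤ q.num + M * q.den := by
      have h1 : (1 : ℤ) ≤ q.den := by exact_mod_cast q.den_pos
      have h2 : -q.num ≤ M := by omega
      nlinarith [Int.natCast_nonneg M]
    obtain ⟨n, hn⟩ := Int.eq_ofNat_of_zero_le hnn
    have hn' : (n : ℝ) = q.num + M * q.den := by exact_mod_cast hn.symm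
    have e : -(M : ℝ) + n * (q.den : ℝ)⁻¹ = q := by
      rw [hn', Rat.cast_def]
      field_simp
      ring
    have := hPg n
    rwa [e] at this
  have hint := Lagrange.eq_interpolate_of_eval_eq (s := Finset.range N)
    (v := fun j : ℕ => (j : ℂ)) (fun i : ℕ => g i) hinj (by simpa using hP)
    fun i _ => (hnode i).symm
  change g q = _
  rw [hq, hint, Lagrange.interpolate_apply, eval_finsetSum]
  simp

/-- A continuous function on `ℝ^d` all of whose `N`-th differences vanish is a polynomial. -/
theorem exists_mvPolynomial_of_fwdDiff_iter_eq_zero {d : ℕ} (f : (Fin d → ℝ) → ℂ)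
    (hf : Continuous f) (N : ℕ) (hfN : ∀ s, (fwdDiff s)^[N] f = 0) :
    ∃ p : MvPolynomial (Fin d) ℂ, ∀ x, f x = MvPolynomial.eval (fun j => (x j : ℂ)) p := by
  classical
  have hupd : ∀ (x : Fin d → ℝ) (j : Fin d) (t : ℝ), f (Function.update x j t) =
      ∑ i ∈ Finset.range N, f (Function.update x j i) *
        (Lagrange.basis (Finset.range N) (fun j : ℕ => (j : ℂ)) i).eval (t : ℂ) := by
    intro x j t
    refine eq_interpolate_of_fwdDiff_iter_eq_zero (fun t => f (Function.update x j t))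
      (hf.comp (by fun_prop)) N (fun s => funext fun u => ?_) t
    have h := congrFun (hfN (Pi.single j s)) (Function.update x j u)
    rw [fwdDiff_iter_eq_sum_shift] at h ⊢
    refine Eq.trans ?_ h
    refine Finset.sum_congr rfl fun k _ => ?_
    congr 2
    ext i
    rcases eq_or_ne i j with rfl | hij
    · simp
    · simp [hij]
  have hpart : ∀ (S : Finset (Fin d)) (w : Fin d → ℝ), ∃ p : MvPolynomial (Fin d) ℂ,
      ∀ x : Fin d → ℝ, f (S.piecewise x w) = MvPolynomial.eval (fun j => (x j : ℂ)) p := by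
    intro S
    induction S using Finset.induction_on with
    | empty => exact fun w => ⟨MvPolynomial.C (f w), fun x => by simp⟩
    | insert j S hj ih =>
      intro w
      choose p hp using fun i : ℕ => ih (Function.update w j i)
      refine ⟨∑ i ∈ Finset.range N, p i * Polynomial.aeval (MvPolynomial.X j)
        (Lagrange.basis (Finset.range N) (fun j : ℕ => (j : ℂ)) i), fun x => ?_⟩
      rw [Finset.piecewise_insert, hupd, map_sum]
      refine Finset.sum_congr rfl fun i _ => ?_
      rw [map_mul, ← hp, Finset.update_piecewise_of_notMem _ _ _ hj]
      congr 1
      rw [← MvPolynomial.coe_aeval_eq_eval, RingHom.coe_coe, ← Polynomial.aeval_algHom_apply,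
        MvPolynomial.aeval_X, Polynomial.coe_aeval_eq_eval]
  obtain ⟨p, hp⟩ := hpart Finset.univ 0
  exact ⟨p, fun x => by simpa using hp x⟩

/-- A vector of norm at most `δ` is the sum of two vectors of norm `δ`. -/
theorem exists_add_eq_of_norm_le {E : Type*} [NormedAddCommGroup E] [InnerProductSpace ℝ E]
    [FiniteDimensional ℝ E] (hE : 2 ≤ Module.finrank ℝ E) {δ : ℝ} (hδ : 0 < δ) (h : E)
    (hh : ‖h‖ ≤ δ) : ∃ y z : E, ‖y‖ = δ ∧ ‖z‖ = δ ∧ y + z = h := by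
  have hlt : Module.finrank ℝ (ℝ ∙ h) < Module.finrank ℝ E := by
    have := finrank_span_le_card (R := ℝ) ({h} : Set E)
    simp only [Set.toFinset_singleton, Finset.card_singleton] at this
    omega
  obtain ⟨v, hv, hv0⟩ := Submodule.exists_mem_ne_zero_of_ne_bot
    (mt (Submodule.orthogonal_eq_bot_iff (K := ℝ ∙ h)).1 fun e => hlt.ne (by rw [e, finrank_top]))
  have hvh : inner ℝ h v = 0 := Submodule.mem_orthogonal_singleton_iff_inner_right.1 hv
  have hnv : ‖v‖ ≠ 0 := norm_ne_zero_iff.2 hv0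
  set c := √(δ ^ 2 - ‖h‖ ^ 2 / 4)
  have hc : c ^ 2 = δ ^ 2 - ‖h‖ ^ 2 / 4 :=
    Real.sq_sqrt (by nlinarith [norm_nonneg h])
  have hy : ∀ ε : ℝ, ε ^ 2 = 1 → ‖(1 / 2 : ℝ) • h + (ε * c / ‖v‖) • v‖ = δ := fun ε hε => by
    have : ‖(1 / 2 : ℝ) • h + (ε * c / ‖v‖) • v‖ ^ 2 = δ ^ 2 := by
      rw [norm_add_sq_real, inner_smul_left, inner_smul_right, hvh, norm_smul, norm_smul,
        mul_pow, mul_pow, Real.norm_eq_abs, Real.norm_eq_abs, sq_abs, sq_abs]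
      field_simp
      rw [hε, hc]
      ring
    exact (sq_eq_sq₀ (norm_nonneg _) hδ.le).1 this
  refine ⟨_, _, hy 1 (by norm_num), hy (-1) (by norm_num), by module⟩

theorem stmt_9 {d n : ℕ} (hd : 2 ≤ d) (hn : 1 ≤ n) (δ : ℝ) (hδ : 0 < δ)
    (a : ℕ → ℂ) (han : a n ≠ 0)
    (f : EuclideanSpace ℝ (Fin d) → ℂ) (hf : Continuous f)
    (heq : ∀ x y : EuclideanSpace ℝ (Fin d), ‖y‖ = δ →
      ∑ k ∈ Finset.range (n + 1), a k * f (x + (k : ℝ) • y) = 0) :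
    IsPolyFunE f := by
  set p : Polynomial ℂ := ∑ k ∈ Finset.range (n + 1), Polynomial.monomial k (a k) with hp
  have hp0 : p ≠ 0 := fun h => han <| by
    simpa [hp, Polynomial.finsetSum_coeff, Polynomial.coeff_monomial] using
      congrArg (Polynomial.coeff · n) h
  have hsphere : ∀ y : EuclideanSpace ℝ (Fin d), ‖y‖ = δ →
      Polynomial.aeval (groupElem y) p ∈ translationAnnihilator f := fun y hy => by
    rw [mem_translationAnnihilator]
    ext x
    rw [Pi.zero_apply, ← heq x y hy, hp, map_sum, map_sum, LinearMap.sum_apply, Finset.sum_apply]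
    refine Finset.sum_congr rfl fun k _ => ?_
    rw [Polynomial.aeval_monomial, ← groupElem_nsmul, ← Algebra.smul_def, map_smul,
      LinearMap.smul_apply, Pi.smul_apply, translationAction_single, one_mul, smul_eq_mul,
      Nat.cast_smul_eq_nsmul]
  obtain ⟨q, hq, hqmul⟩ := exists_monic_aeval_mul_mem p hp0
  have hball : ∀ h : EuclideanSpace ℝ (Fin d), ‖h‖ ≤ δ →
      Polynomial.aeval (groupElem h) q ∈ translationAnnihilator f := fun h hh => by
    obtain ⟨y, z, hy, hz, rfl⟩ := exists_add_eq_of_norm_le (by simpa using hd) hδ h hh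
    rw [groupElem_add]
    exact hqmul _ _ _ _ (hsphere y hy) (hsphere z hz)
  have hdiff : ∀ s, (fwdDiff s)^[q.natDegree] f = 0 := fun s => by
    have h := prod_groupElem_sub_one_mem _ q hq δ hδ hball fun _ => s
    rw [Finset.prod_const, Finset.card_range, mem_translationAnnihilator, map_pow] at h
    rw [← h, Module.End.pow_apply]
    congr 1
    exact (funext fun F => translationAction_groupElem_sub_one s F).symm
  obtain ⟨P, hP⟩ := exists_mvPolynomial_of_fwdDiff_iter_eq_zero (fun x => f (WithLp.toLp 2 x))
    (hf.comp (PiLp.continuous_toLp 2 _)) q.natDegree fun s => funext fun x => by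
      have h := congrFun (hdiff (WithLp.toLp 2 s)) (WithLp.toLp 2 x)
      rw [fwdDiff_iter_eq_sum_shift] at h ⊢
      exact h
  exact ⟨P, fun x => hP x.ofLp⟩
end

section
/- Let n ≥ 1 be an integer, let a_0, a_1, …, a_n ∈ ℂ with a_n ≠ 0, and let U ⊆ ℝ be a nonempty open set. Let f : ℝ → ℂ be a continuous function such that ∑_{k=0}^n a_k f(x + k y) = 0 for all x ∈ ℝ and all y ∈ U. Then f is a polynomial function, i.e. there is a polynomial p with complex coefficients such that f(x) = p(x) for all x ∈ ℝ. -/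
open fwdDiff in
/-- If `f z + ∑ k, g k (z + c k * y)` vanishes for all `z` and all `y` near `y₀`, then taking
differences along suitable directions kills the terms `g k` one at a time. -/
theorem fwdDiff_iter_eq_zero_of_add_sum_eq_zero (y₀ t : ℝ) (ht : 0 ≤ t) (c : ℕ → ℝ) (m : ℕ)
    (hc : ∀ k < m, 1 ≤ |c k|) (f : ℝ → ℂ) (g : ℕ → ℝ → ℂ)
    (h : ∀ z y : ℝ, |y - y₀| ≤ m * t → f z + ∑ k ∈ Finset.range m, g k (z + c k * y) = 0) :
    (Δ_[t])^[m] f = 0 := by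
  induction m generalizing f g with
  | zero =>
    funext z
    simpa using h z y₀ (by simp)
  | succ m ih =>
    rw [Function.iterate_succ_apply]
    refine ih (fun k hk => hc k (by omega)) _
      (fun k w => g k (w + (t - c k * (t / c m))) - g k w) fun z y hy => ?_
    have hcm := hc m (by omega)
    have hcm0 : c m ≠ 0 := by
      intro h0
      rw [h0, abs_zero] at hcm
      linarith
    have hdiv : |t / c m| ≤ t := by
      rw [abs_div, abs_of_nonneg ht]
      exact div_le_self ht hcm
    have h1 := h (z + t) (y - t / c m) (by
      push_cast
      rw [abs_le] at *
      constructor <;> linarith [hy.1, hy.2, hdiv.1, hdiv.2])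
    have h2 := h z y (by push_cast; linarith)
    rw [Finset.sum_range_succ] at h1 h2
    have e : z + t + c m * (y - t / c m) = z + c m * y := by
      field_simp
      ring
    rw [e] at h1
    have e2 : ∀ k, z + c k * y + (t - c k * (t / c m)) = z + t + c k * (y - t / c m) :=
      fun k => by ring
    simp only [fwdDiff, e2, Finset.sum_sub_distrib]
    linear_combination h1 - h2

open fwdDiff in
/-- A function annihilated by an iterated difference of step `h` agrees with a polynomial on each
progression of step `h`. -/
theorem exists_polynomial_eval_progression_of_fwdDiff_iter_eq_zero {f : ℝ → ℂ} {h : ℝ}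
    (hh : h ≠ 0) {n : ℕ} (hf : (Δ_[h])^[n] f = 0) (b : ℝ) :
    ∃ q : Polynomial ℂ, ∀ N : ℕ, f (b + N * h) = q.eval ((b + N * h : ℝ) : ℂ) := by
  have hzero : ∀ k, n ≤ k → (Δ_[h])^[k] f b = 0 := by
    intro k hk
    obtain ⟨d, rfl⟩ := Nat.exists_eq_add_of_le' hk
    rw [Function.iterate_add_apply, hf]
    have : (Δ_[h])^[d] (0 : ℝ → ℂ) = 0 :=
      Function.iterate_fixed (by funext x; simp [fwdDiff]) d
    rw [this]
    rfl
  refine ⟨∑ k ∈ Finset.range n, Polynomial.C ((Δ_[h])^[k] f b / (k.factorial : ℂ)) *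
    (descPochhammer ℂ k).comp (Polynomial.C (h : ℂ)⁻¹ * (Polynomial.X - Polynomial.C (b : ℂ))),
    fun N => ?_⟩
  have hh' : (h : ℂ) ≠ 0 := by exact_mod_cast hh
  have hN : (h : ℂ)⁻¹ * (((b + N * h : ℝ) : ℂ) - b) = N := by
    push_cast
    field_simp
    ring
  have key := shift_eq_sum_fwdDiff_iter h f N b
  rw [nsmul_eq_mul] at key
  rw [key, Polynomial.eval_finsetSum]
  have hterm : ∀ k, N.choose k • (Δ_[h])^[k] f b = Polynomial.eval ((b + N * h : ℝ) : ℂ)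
      (Polynomial.C ((Δ_[h])^[k] f b / (k.factorial : ℂ)) * (descPochhammer ℂ k).comp
        (Polynomial.C (h : ℂ)⁻¹ * (Polynomial.X - Polynomial.C (b : ℂ)))) := by
    intro k
    simp only [Polynomial.eval_mul, Polynomial.eval_C, Polynomial.eval_comp, Polynomial.eval_sub,
      Polynomial.eval_X, hN]
    rw [nsmul_eq_mul, Nat.cast_choose_eq_descPochhammer_div]
    ring
  rw [← Finset.sum_congr rfl fun k _ => hterm k]
  rcases le_total (N + 1) n with hle | hle
  · refine Finset.sum_subset (Finset.range_mono hle) fun k _ hk => ?_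
    rw [Nat.choose_eq_zero_of_lt (by simpa using hk), zero_smul]
  · refine (Finset.sum_subset (Finset.range_mono hle) fun k _ hk => ?_).symm
    rw [hzero k (by simpa using hk), smul_zero]

open fwdDiff in
/-- A continuous function annihilated by the `n`-th iterated differences of all steps `1 / m` with
`m` large is a polynomial. -/
theorem exists_polynomial_of_fwdDiff_iter_eq_zero {f : ℝ → ℂ} (hf : Continuous f) {n M : ℕ}
    (hM : 0 < M) (h : ∀ m : ℕ, M ≤ m → (Δ_[(1 / m : ℝ)])^[n] f = 0) :
    ∃ p : Polynomial ℂ, ∀ x : ℝ, f x = p.eval (x : ℂ) := by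
  have hprog : ∀ m : ℕ, M ≤ m → ∀ B : ℕ, ∃ q : Polynomial ℂ, ∀ N : ℕ,
      f (-B + N * (1 / m)) = q.eval ((-B + N * (1 / m) : ℝ) : ℂ) := fun m hm B =>
    exists_polynomial_eval_progression_of_fwdDiff_iter_eq_zero
      (one_div_ne_zero (by exact_mod_cast (hM.trans_le hm).ne')) (h m hm) _
  have hnat : ∀ m : ℕ, M ≤ m → ∀ B : ℕ, ∀ q : Polynomial ℂ, (∀ N : ℕ,
      f (-B + N * (1 / m)) = q.eval ((-B + N * (1 / m) : ℝ) : ℂ)) →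
      ∀ j : ℕ, f j = q.eval (j : ℂ) := by
    intro m hm B q hq j
    have hm0 : (m : ℝ) ≠ 0 := by exact_mod_cast (hM.trans_le hm).ne'
    have e : (-B + ((j + B) * m : ℕ) * (1 / m) : ℝ) = j := by
      push_cast
      field_simp
      ring
    have := hq ((j + B) * m)
    rw [e] at this
    simpa using this
  obtain ⟨p, hp⟩ := hprog M le_rfl 0
  have hpnat := hnat M le_rfl 0 p hp
  refine ⟨p, fun x => ?_⟩
  have hrat : ∀ r : ℚ, f r = p.eval ((r : ℝ) : ℂ) := by
    intro r
    have hm : M ≤ r.den * M := Nat.le_mul_of_pos_left M r.pos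
    obtain ⟨q, hq⟩ := hprog (r.den * M) hm r.num.natAbs
    have hqnat := hnat _ hm _ q hq
    have hpq : p = q := by
      refine Polynomial.eq_of_infinite_eval_eq p q
        ((Set.infinite_range_of_injective (Nat.cast_injective (R := ℂ))).mono ?_)
      rintro _ ⟨j, rfl⟩
      exact (hpnat j).symm.trans (hqnat j)
    obtain ⟨s, hs⟩ : ∃ s : ℕ, (s : ℤ) = r.num + r.num.natAbs * r.den := by
      refine ⟨(r.num + r.num.natAbs * r.den).toNat, Int.toNat_of_nonneg ?_⟩
      have h1 : (1 : ℤ) ≤ r.den := by exact_mod_cast r.pos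
      have h2 : (0 : ℤ) ≤ r.num.natAbs := by positivity
      have h3 : -r.num ≤ r.num.natAbs := by omega
      nlinarith
    have hs' : (s : ℝ) = r.num + r.num.natAbs * r.den := by
      simpa only [Int.cast_add, Int.cast_mul, Int.cast_natCast] using congrArg (Int.cast (R := ℝ)) hs
    have hd : (r.den : ℝ) ≠ 0 := by exact_mod_cast r.den_nz
    have hM0 : (M : ℝ) ≠ 0 := by exact_mod_cast hM.ne'
    have e : (-r.num.natAbs + (s * M : ℕ) * (1 / (r.den * M : ℕ)) : ℝ) = r := by
      rw [Rat.cast_def r, Nat.cast_mul, Nat.cast_mul, hs']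
      field_simp
      ring
    have := hq (s * M)
    rw [e] at this
    rw [this, hpq]
  have hcont : Continuous fun x : ℝ => p.eval (x : ℂ) := p.continuous.comp Complex.continuous_ofReal
  exact congrFun (Rat.isDenseEmbedding_coe_real.dense.equalizer hf hcont (funext hrat)) x

theorem stmt_10 {n : ℕ} (hn : 1 ≤ n) (a : ℕ → ℂ) (han : a n ≠ 0)
    (U : Set ℝ) (hU : IsOpen U) (hUne : U.Nonempty)
    (f : ℝ → ℂ) (hf : Continuous f)
    (heq : ∀ x : ℝ, ∀ y ∈ U, ∑ k ∈ Finset.range (n + 1), a k * f (x + k * y) = 0) :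
    ∃ p : Polynomial ℂ, ∀ x : ℝ, f x = p.eval (x : ℂ) := by
  obtain ⟨y₀, hy₀⟩ := hUne
  obtain ⟨ε, hε, hball⟩ := Metric.isOpen_iff.1 hU y₀ hy₀
  obtain ⟨M, hM⟩ := exists_nat_gt (n / ε)
  have hM0 : (0 : ℝ) < M := lt_of_le_of_lt (by positivity) hM
  refine exists_polynomial_of_fwdDiff_iter_eq_zero (n := n) hf (Nat.cast_pos.1 hM0) fun m hm => ?_
  have hmM : (M : ℝ) ≤ m := by exact_mod_cast hm
  have hm0 : (0 : ℝ) < m := hM0.trans_le hmM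
  refine fwdDiff_iter_eq_zero_of_add_sum_eq_zero y₀ _ (by positivity) (fun k => (k : ℝ) - n) n
    (fun k hk => ?_) f (fun k w => (a n)⁻¹ * (a k * f w)) fun z y hy => ?_
  · have : (k : ℝ) + 1 ≤ n := by exact_mod_cast hk
    rw [abs_of_nonpos (by linarith)]
    linarith
  · have hyU : y ∈ U := by
      apply hball
      rw [Metric.mem_ball, Real.dist_eq]
      refine hy.trans_lt ?_
      rw [mul_one_div, div_lt_iff₀ hm0]
      rw [div_lt_iff₀ hε] at hM
      nlinarith
    have h := heq (z - n * y) y hyU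
    rw [Finset.sum_range_succ, sub_add_cancel] at h
    have e : ∀ k : ℕ, z + ((k : ℝ) - n) * y = z - n * y + k * y := fun k => by ring
    simp only [e, ← Finset.mul_sum]
    rw [eq_neg_of_add_eq_zero_left h]
    field_simp
    ring
end

section
/- Let d ≥ 2 be an integer and let δ > 0. Then there exist finitely many points h_1, …, h_s ∈ ℝ^d with ‖h_i‖ = δ for all i (Euclidean norm) such that the additive subgroup h_1 ℤ + ⋯ + h_s ℤ generated by h_1, …, h_s is dense in ℝ^d. -/
/-- An additive subgroup containing `a • v` and `b • v` with `a / b` irrational has the whole line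
through `v` in its topological closure. -/
theorem AddSubgroup.smul_mem_topologicalClosure_of_irrational_div {E : Type*}
    [NormedAddCommGroup E] [NormedSpace ℝ E] (G : AddSubgroup E) {a b : ℝ}
    (hab : Irrational (a / b)) {v : E} (ha : a • v ∈ G) (hb : b • v ∈ G) (t : ℝ) :
    t • v ∈ G.topologicalClosure := by
  have hdense := dense_addSubgroupClosure_pair_iff.2 hab
  have hclosed : IsClosed {t : ℝ | t • v ∈ G.topologicalClosure} :=
    G.isClosed_topologicalClosure.preimage (continuous_id.smul continuous_const)
  have hle : AddSubgroup.closure {a, b} ≤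
      G.topologicalClosure.comap ((LinearMap.toSpanSingleton ℝ E v).toAddMonoidHom) := by
    rw [AddSubgroup.closure_le]
    rintro x (rfl | rfl)
    · exact G.le_topologicalClosure ha
    · exact G.le_topologicalClosure hb
  exact hclosed.closure_subset_iff.2 (fun x hx => hle hx) (hdense t)

/-- A subgroup of Euclidean space whose closure contains all coordinate axes is dense. -/
theorem EuclideanSpace.dense_of_smul_single_mem {ι : Type*} [Fintype ι] [DecidableEq ι]
    (G : AddSubgroup (EuclideanSpace ℝ ι))
    (hG : ∀ i (t : ℝ), t • EuclideanSpace.single i (1 : ℝ) ∈ G.topologicalClosure) :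
    Dense (G : Set (EuclideanSpace ℝ ι)) := by
  intro x
  have hx := (EuclideanSpace.basisFun ι ℝ).sum_repr x
  rw [← G.topologicalClosure_coe, SetLike.mem_coe, ← hx]
  refine sum_mem fun i _ => ?_
  rw [EuclideanSpace.basisFun_apply]
  exact hG i _

/-- If `u` and `v` are orthonormal, then `(c / √2) • (u + v)` has norm `c`. -/
theorem norm_div_sqrt_two_smul_add {E : Type*} [NormedAddCommGroup E] [InnerProductSpace ℝ E]
    {u v : E} (hu : ‖u‖ = 1) (hv : ‖v‖ = 1) (huv : inner ℝ u v = 0) {c : ℝ} (hc : 0 ≤ c) :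
    ‖(c / √2) • (u + v)‖ = c := by
  have h : ‖u + v‖ = √2 := by
    rw [eq_comm, Real.sqrt_eq_iff_mul_self_eq (by norm_num) (norm_nonneg _),
      norm_add_sq_eq_norm_sq_add_norm_sq_of_inner_eq_zero u v huv, hu, hv]
    norm_num
  rw [norm_smul, h, Real.norm_of_nonneg (by positivity)]
  field_simp

theorem stmt_12 {d : ℕ} (hd : 2 ≤ d) (δ : ℝ) (hδ : 0 < δ) :
    ∃ (s : ℕ) (h : Fin s → EuclideanSpace ℝ (Fin d)),
      (∀ i, ‖h i‖ = δ) ∧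
        Dense ((AddSubgroup.closure (Set.range h) : AddSubgroup (EuclideanSpace ℝ (Fin d))) :
          Set (EuclideanSpace ℝ (Fin d))) := by
  have : Nontrivial (Fin d) := Fin.nontrivial_iff_two_le.2 hd
  choose j hj using fun i : Fin d => exists_ne i
  let e : Fin d → EuclideanSpace ℝ (Fin d) := fun i => EuclideanSpace.single i 1
  have he : ∀ i, ‖e i‖ = 1 := fun i => by simp [e]
  have hinner : ∀ i, inner ℝ (e i) (e (j i)) = 0 := fun i => by
    simp [e, EuclideanSpace.inner_single_left, (hj i).symm]
  let S : Set (EuclideanSpace ℝ (Fin d)) :=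
    Set.range (fun i => δ • e i) ∪ (Set.range (fun i => (δ / √2) • (e i + e (j i))) ∪
      Set.range (fun i => (δ / √2) • (e i + -e (j i))))
  have hS : S.Finite :=
    (Set.finite_range _).union ((Set.finite_range _).union (Set.finite_range _))
  obtain ⟨s, h, -, hrange⟩ := hS.fin_param
  refine ⟨s, h, fun k => ?_, ?_⟩
  · have hk : h k ∈ S := hrange ▸ Set.mem_range_self k
    rcases hk with ⟨i, hi⟩ | ⟨i, hi⟩ | ⟨i, hi⟩ <;> rw [← hi]
    · simp [norm_smul, he, abs_of_pos hδ]
    · exact norm_div_sqrt_two_smul_add (he i) (he _) (hinner i) hδ.le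
    · exact norm_div_sqrt_two_smul_add (he i) (by rw [norm_neg, he])
        (by rw [inner_neg_right, hinner, neg_zero]) hδ.le
  · rw [hrange]
    refine EuclideanSpace.dense_of_smul_single_mem _ fun i t => ?_
    refine AddSubgroup.smul_mem_topologicalClosure_of_irrational_div _ (a := √2 * δ) (b := δ)
      ?_ ?_ ?_ t
    · rw [mul_div_cancel_right₀ _ hδ.ne']
      exact irrational_sqrt_two
    · have hadd := add_mem
        (AddSubgroup.subset_closure (Or.inr (Or.inl ⟨i, rfl⟩)) :
          (δ / √2) • (e i + e (j i)) ∈ AddSubgroup.closure S)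
        (AddSubgroup.subset_closure (Or.inr (Or.inr ⟨i, rfl⟩)) :
          (δ / √2) • (e i + -e (j i)) ∈ AddSubgroup.closure S)
      have hcoef : √2 * δ = δ / √2 + δ / √2 := by
        field_simp
        rw [Real.sq_sqrt (by norm_num)]
        norm_num
      have hsum : (√2 * δ) • e i =
          (δ / √2) • (e i + e (j i)) + (δ / √2) • (e i + -e (j i)) := by
        rw [hcoef]
        module
      exact hsum ▸ hadd
    · exact AddSubgroup.subset_closure (Or.inl ⟨i, rfl⟩)
end

section
/- Let d ≥ 1, let p be a multivariate polynomial in d variables with complex coefficients, let h ∈ ℝ^d, and let Q(z) = ∑_{k=0}^n q_k z^k be a complex polynomial in one variable with Q(1) ≠ 0. If ∑_{k=0}^n q_k p(x + k·h) = 0 for all x ∈ ℝ^d (where k·h denotes the scalar multiple of h by the integer k), then p = 0. -/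
/-- A univariate polynomial annihilated by a combination of integer translations whose coefficients
have nonzero sum is zero: the leading coefficient is translation invariant. -/
theorem Polynomial.eq_zero_of_sum_mul_eval_add_eq_zero (P : Polynomial ℂ) (s : Finset ℕ)
    (q : ℕ → ℂ) (hq : ∑ k ∈ s, q k ≠ 0)
    (hP : ∀ t : ℝ, ∑ k ∈ s, q k * P.eval ((t : ℂ) + k) = 0) : P = 0 := by
  have hsum : ∑ k ∈ s, Polynomial.C (q k) * Polynomial.taylor (k : ℂ) P = 0 := by
    refine Polynomial.eq_zero_of_infinite_isRoot _
      ((Set.infinite_range_of_injective Complex.ofReal_injective).mono ?_)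
    rintro _ ⟨t, rfl⟩
    simpa [Polynomial.IsRoot, Polynomial.eval_finsetSum, Polynomial.taylor_eval] using hP t
  have hlead := congrArg (fun R => R.coeff P.natDegree) hsum
  simp only [Polynomial.finsetSum_coeff, Polynomial.coeff_C_mul,
    Polynomial.coeff_taylor_natDegree, Polynomial.coeff_zero, ← Finset.sum_mul] at hlead
  exact Polynomial.leadingCoeff_eq_zero.mp ((mul_eq_zero.mp hlead).resolve_left hq)

/-- A complex polynomial vanishing at all real points is zero. -/
theorem MvPolynomial.eq_zero_of_eval_ofReal_eq_zero {σ : Type*} (p : MvPolynomial σ ℂ)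
    (hp : ∀ x : σ → ℝ, MvPolynomial.eval (fun j => (x j : ℂ)) p = 0) : p = 0 := by
  refine MvPolynomial.funext_set (fun _ => Set.range ((↑) : ℝ → ℂ))
    (fun _ => Set.infinite_range_of_injective Complex.ofReal_injective) fun z hz => ?_
  choose x hx using fun j => hz j (Set.mem_univ j)
  simpa [hx] using hp x

theorem stmt_14 {d : ℕ} (hd : 1 ≤ d) (p : MvPolynomial (Fin d) ℂ)
    (h : Fin d → ℝ) {n : ℕ} (q : ℕ → ℂ)
    (hQ1 : ∑ k ∈ Finset.range (n + 1), q k ≠ 0)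
    (heq : ∀ x : Fin d → ℝ,
      ∑ k ∈ Finset.range (n + 1),
        q k * MvPolynomial.eval (fun j => ((x j + (k : ℝ) * h j : ℝ) : ℂ)) p = 0) :
    p = 0 := by
  refine MvPolynomial.eq_zero_of_eval_ofReal_eq_zero p fun x => ?_
  -- the restriction of `p` to the line through `x` in direction `h`
  let P : Polynomial ℂ :=
    MvPolynomial.aeval (fun j => Polynomial.C (x j : ℂ) + Polynomial.C (h j : ℂ) * Polynomial.X) p
  have hP (z : ℂ) : P.eval z = MvPolynomial.eval (fun j => (x j : ℂ) + h j * z) p := by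
    simp [P, MvPolynomial.aeval_def, MvPolynomial.eval₂_eq', MvPolynomial.eval_eq',
      Polynomial.eval_finsetSum, Polynomial.eval_prod]
  have hP0 : P = 0 := by
    refine P.eq_zero_of_sum_mul_eval_add_eq_zero _ q hQ1 fun t => ?_
    rw [← heq fun j => x j + t * h j]
    refine Finset.sum_congr rfl fun k _ => ?_
    rw [hP]
    congr 3 with j
    push_cast
    ring
  simpa [hP0] using (hP 0).symm
end

section
/- Let d ≥ 2 be an integer, let p be a nonzero multivariate polynomial in d variables with complex coefficients, let λ ∈ ℂ^d, and let M ≥ 1 be an integer. Suppose that for all h ∈ ℝ^d and all x ∈ ℝ^d, ∑_{j=0}^{M} binom(M,j) (−1)^{M−j} exp(j ⟨λ, h⟩) p(x + j·h) = 0, where ⟨λ, h⟩ = ∑_{l=1}^d λ_l h_l and j·h denotes the scalar multiple of h by the integer j. Then λ = 0. -/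
open Polynomial in
/-- If a combination of integer translates of a nonzero univariate polynomial over `ℂ`
vanishes, so does the sum of the coefficients, as translation keeps the leading term. -/
theorem Polynomial.sum_eq_zero_of_sum_translates_eq_zero {g : ℂ[X]} (hg : g ≠ 0)
    (s : Finset ℕ) (c : ℕ → ℂ)
    (h : ∀ r : ℝ, ∑ j ∈ s, c j * g.eval ((r : ℂ) + j) = 0) : ∑ j ∈ s, c j = 0 := by
  have hpoly : ∑ j ∈ s, C (c j) * taylor (j : ℂ) g = 0 := by
    refine eq_zero_of_infinite_isRoot _ ((Set.infinite_range_of_injective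
      Complex.ofReal_injective).mono ?_)
    rintro _ ⟨r, rfl⟩
    simpa [IsRoot, eval_finsetSum, taylor_eval] using h r
  have hcoeff := congrArg (fun q => q.coeff g.natDegree) hpoly
  simp only [finsetSum_coeff, coeff_C_mul, coeff_taylor_natDegree, coeff_zero,
    ← Finset.sum_mul] at hcoeff
  exact (mul_eq_zero.mp hcoeff).resolve_right (leadingCoeff_ne_zero.mpr hg)

/-- A polynomial annihilated by `(w τ_h - 1) ^ M` with `w ≠ 1` vanishes at every real point. -/
theorem MvPolynomial.eval_eq_zero_of_twisted_difference {σ : Type*} (p : MvPolynomial σ ℂ)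
    (h : σ → ℝ) {w : ℂ} (hw : w ≠ 1) (M : ℕ)
    (heq : ∀ x : σ → ℝ, ∑ j ∈ Finset.range (M + 1),
      (M.choose j : ℂ) * (-1 : ℂ) ^ (M - j) * w ^ j *
        MvPolynomial.eval (fun t => ((x t + (j : ℝ) * h t : ℝ) : ℂ)) p = 0)
    (x : σ → ℝ) : MvPolynomial.eval (fun t => (x t : ℂ)) p = 0 := by
  set g : Polynomial ℂ := MvPolynomial.aeval
    (fun t => Polynomial.C (x t : ℂ) + Polynomial.C (h t : ℂ) * Polynomial.X) p with hgdef
  have hg (z : ℂ) : g.eval z = MvPolynomial.eval (fun t => (x t : ℂ) + h t * z) p := by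
    rw [hgdef, ← Polynomial.coe_aeval_eq_eval, ← MvPolynomial.coe_aeval_eq_eval]
    change Polynomial.aeval z _ = MvPolynomial.aeval _ p
    rw [MvPolynomial.comp_aeval_apply]
    simp
  by_cases hg0 : g = 0
  · simpa [hg0] using (hg 0).symm
  have hsum := Polynomial.sum_eq_zero_of_sum_translates_eq_zero hg0 (Finset.range (M + 1))
    (fun j => (M.choose j : ℂ) * (-1 : ℂ) ^ (M - j) * w ^ j) fun r => by
      rw [← heq fun t => x t + r * h t]
      refine Finset.sum_congr rfl fun j _ => ?_
      rw [hg]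
      congr 3
      ext t
      push_cast
      ring
  have hpow : (w + -1) ^ M = 0 := by
    rw [add_pow, ← hsum]
    exact Finset.sum_congr rfl fun j _ => by ring
  exact absurd (add_neg_eq_zero.mp (eq_zero_of_pow_eq_zero hpow)) hw

theorem Complex.eq_zero_of_forall_exp_mul_ofReal_eq_one {a : ℂ}
    (h : ∀ t : ℝ, Complex.exp (a * t) = 1) : a = 0 := by
  have hd : HasDerivAt (fun t : ℝ => Complex.exp (a * t)) a 0 := by
    have := (Complex.ofRealCLM.hasDerivAt (x := 0)).const_mul a |>.cexp
    simpa using this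
  rw [funext h] at hd
  exact hd.unique (hasDerivAt_const _ _)

theorem stmt_15 {d : ℕ} (hd : 2 ≤ d) (p : MvPolynomial (Fin d) ℂ) (hp : p ≠ 0)
    (lam : Fin d → ℂ) {M : ℕ} (hM : 1 ≤ M)
    (heq : ∀ h x : Fin d → ℝ,
      ∑ j ∈ Finset.range (M + 1),
        (M.choose j : ℂ) * (-1 : ℂ) ^ (M - j) *
          Complex.exp ((j : ℂ) * ∑ l, lam l * (h l : ℂ)) *
          MvPolynomial.eval (fun t => ((x t + (j : ℝ) * h t : ℝ) : ℂ)) p = 0) :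
    lam = 0 := by
  have hexp (h : Fin d → ℝ) : Complex.exp (∑ l, lam l * (h l : ℂ)) = 1 := by
    by_contra hw
    refine hp (MvPolynomial.funext_set (fun _ => Set.range ((↑) : ℝ → ℂ))
      (fun _ => Set.infinite_range_of_injective Complex.ofReal_injective) fun y hy => ?_)
    choose x hx using fun i => hy i (Set.mem_univ i)
    obtain rfl : (fun i => (x i : ℂ)) = y := funext hx
    rw [map_zero]
    refine p.eval_eq_zero_of_twisted_difference h hw M (fun x => ?_) x
    simpa only [← Complex.exp_nat_mul] using heq h x
  funext l
  refine Complex.eq_zero_of_forall_exp_mul_ofReal_eq_one fun t => ?_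
  simpa [Pi.single_apply, apply_ite] using hexp (Pi.single l t)
end
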